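/- arXiv:0712.2551 — 10 statements merged into one kernel-verified Lean document; each statement's English description precedes it below -/
import Mathlib

section
/- Let D = k⟨x1,x2,x3,x4⟩/(r1,…,r6) be a quadratic algebra whose six defining relations r_m = Σ_{i,j=1}^{4} a^m_{ij} x_i x_j (a^m_{ij} ∈ k) satisfy a^m_{44} = a^m_{43} = a^m_{34} = 0 for all m = 1,…,6 (no x4x4, x4x3, or x3x4 terms). Then the images in D of the monomials x4^{n0} x3 x4^{n1} x3 x4^{n2} ⋯ x3 x4^{ns}, taken over all s ≥ 0 and all integer tuples (n0, n1, …, ns) with n0 ≥ 0, ns ≥ 0, and n1, …, n_{s-1} ≥ 1, are linearly independent over k. -/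
noncomputable section

open FreeAlgebra

/-- The relation used to quotient a free algebra by the two-sided
ideal generated by the set `s`. -/
def genRel {k : Type} [Field k] {n : ℕ} (s : Set (FreeAlgebra k (Fin n))) :
    FreeAlgebra k (Fin n) → FreeAlgebra k (Fin n) → Prop :=
  fun a b => a ∈ s ∧ b = 0

/-- The degree-`m` homogeneous component of the free algebra:
the span of the words of length `m` in the generators. -/
def degF (k : Type) [Field k] (n m : ℕ) : Submodule k (FreeAlgebra k (Fin n)) :=
  (Submodule.span k (Set.range (FreeAlgebra.ι k)) : Submodule k (FreeAlgebra k (Fin n))) ^ m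

/-- The degree-`m` component of the quotient algebra: the image of the span of
the words of length `m`. -/
def degQ (k : Type) [Field k] {n : ℕ} (s : Set (FreeAlgebra k (Fin n))) (m : ℕ) :
    Submodule k (RingQuot (genRel s)) :=
  (degF k n m).map (RingQuot.mkAlgHom k (genRel s)).toLinearMap

/-- A generic quadratic element with coefficients `c`, in the generators
`x1 = ι 0, …, x4 = ι 3`. -/
def quad (k : Type) [Field k] {n : ℕ} (c : Fin n → Fin n → k) : FreeAlgebra k (Fin n) :=
  ∑ i, ∑ j, c i j • (FreeAlgebra.ι k i * FreeAlgebra.ι k j)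

/-- The monomial `x4^{n0} x3 x4^{n1} x3 ⋯ x3 x4^{ns}` associated to the list
`[n0, n1, …, ns]`, where `x3 = ι 2` and `x4 = ι 3`. -/
def altMon (k : Type) [Field k] : List ℕ → FreeAlgebra k (Fin 4)
  | [] => 1
  | [n] => (FreeAlgebra.ι k 3) ^ n
  | n :: rest => (FreeAlgebra.ι k 3) ^ n * FreeAlgebra.ι k 2 * altMon k rest

/-- A list `[n0, n1, …, ns]` is admissible when it is nonempty and all of its
interior entries `n1, …, n_{s-1}` are positive. -/
def GoodList (l : List ℕ) : Prop :=
  l ≠ [] ∧ ∀ i : ℕ, 0 < i → i + 1 < l.length → 1 ≤ l.getD i 0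

/-- The action of `x3` on exponent lists: prepend a zero exponent, unless this would make
the current head an interior exponent equal to zero. -/
def prependZero (k : Type) [Field k] : Module.End k (List ℕ →₀ k) :=
  Finsupp.lift _ k _ fun
    | [] => 0
    | n :: l => if n = 0 ∧ l ≠ [] then 0 else Finsupp.single (0 :: n :: l) 1

/-- The action of `x4` on exponent lists: increment the leading exponent. -/
def incrHead (k : Type) [Field k] : Module.End k (List ℕ →₀ k) :=
  Finsupp.lift _ k _ fun
    | [] => 0
    | n :: l => Finsupp.single ((n + 1) :: l) 1

/-- The representation of the free algebra on exponent lists in which `x1` and `x2` act by zero. -/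
def expRep (k : Type) [Field k] : FreeAlgebra k (Fin 4) →ₐ[k] Module.End k (List ℕ →₀ k) :=
  FreeAlgebra.lift k ![0, 0, prependZero k, incrHead k]

lemma prependZero_mul_self (k : Type) [Field k] : prependZero k * prependZero k = 0 := by
  refine Finsupp.lhom_ext' fun l => LinearMap.ext_ring ?_
  rcases l with _ | ⟨n, l⟩
  · simp [prependZero]
  · by_cases h : n = 0 ∧ l ≠ [] <;> simp [prependZero, h]

lemma incrHead_pow_single (k : Type) [Field k] (n m : ℕ) (l : List ℕ) :
    (incrHead k ^ n) (Finsupp.single (m :: l) 1) = Finsupp.single ((m + n) :: l) 1 := by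
  induction n with
  | zero => simp
  | succ n ih => rw [pow_succ', Module.End.mul_apply, ih]; simp [incrHead, add_assoc]

lemma expRep_quad (k : Type) [Field k] (c : Fin 4 → Fin 4 → k)
    (h : c 3 3 = 0 ∧ c 3 2 = 0 ∧ c 2 3 = 0) : expRep k (quad k c) = 0 := by
  simp [quad, expRep, Fin.sum_univ_four, h, prependZero_mul_self]

lemma GoodList.tail {n m : ℕ} {l : List ℕ} (h : GoodList (n :: m :: l)) : GoodList (m :: l) := by
  refine ⟨by simp, fun i _ hi' => ?_⟩
  simpa using h.2 (i + 1) (by omega) (by simpa using hi')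

lemma expRep_altMon (k : Type) [Field k] (l : List ℕ) (h : GoodList l) :
    expRep k (altMon k l) (Finsupp.single [0] 1) = Finsupp.single l 1 := by
  induction l with
  | nil => exact absurd rfl h.1
  | cons n l ih =>
    rcases l with _ | ⟨m, l⟩
    · simp [altMon, expRep, incrHead_pow_single]
    · have hm : ¬ (m = 0 ∧ l ≠ []) := by
        rintro ⟨rfl, hl⟩
        have := h.2 1 one_pos (by simpa [List.length_pos_iff] using hl)
        simp at this
      have hx3 : expRep k (FreeAlgebra.ι k 2) = prependZero k := by simp [expRep]
      have hx4 : expRep k (FreeAlgebra.ι k 3) = incrHead k := by simp [expRep]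
      have hstep : prependZero k (Finsupp.single (m :: l) 1) =
          Finsupp.single (0 :: m :: l) 1 := by
        simp [prependZero, hm]
      rw [altMon, map_mul, map_mul, map_pow, hx3, hx4, Module.End.mul_apply,
        Module.End.mul_apply, ih h.tail, hstep, incrHead_pow_single, zero_add]
      simp

/-- if the six quadratic defining relations
`r_m = Σ a^m_{ij} x_i x_j` of `D = k⟨x1,x2,x3,x4⟩/(r1,…,r6)` have no
`x4x4`, `x4x3` or `x3x4` terms, then the images in `D` of the monomials
`x4^{n0} x3 x4^{n1} x3 ⋯ x3 x4^{ns}` (with `n0, ns ≥ 0` and interior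
exponents positive) are linearly independent over `k`. -/
theorem stmt0 (k : Type) [Field k] [IsAlgClosed k] [CharZero k]
    (a : Fin 6 → Fin 4 → Fin 4 → k)
    (hno : ∀ m : Fin 6, a m 3 3 = 0 ∧ a m 3 2 = 0 ∧ a m 2 3 = 0) :
    LinearIndependent k
      (fun l : {l : List ℕ // GoodList l} =>
        RingQuot.mkAlgHom k
          (genRel {x : FreeAlgebra k (Fin 4) | ∃ m : Fin 6, x = quad k (a m)})
          (altMon k l.1)) := by
  let φ := RingQuot.liftAlgHom k (s := genRel {x | ∃ m : Fin 6, x = quad k (a m)})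
    ⟨expRep k, by
      rintro _ _ ⟨⟨m, rfl⟩, rfl⟩
      rw [expRep_quad k _ (hno m), map_zero]⟩
  refine LinearIndependent.of_comp
    (LinearMap.applyₗ (Finsupp.single [0] (1 : k)) ∘ₗ φ.toLinearMap) ?_
  convert (Finsupp.basisSingleOne (R := k) (ι := List ℕ)).linearIndependent.comp
    (Subtype.val : {l : List ℕ // GoodList l} → List ℕ) Subtype.val_injective using 1
  funext l
  simpa [φ] using expRep_altMon k l.1 l.2
end
end

section
/- With the type A presentation data and hypotheses given in the context, the natural k-algebra homomorphisms A → D and B → D (sending generators to generators) are injective; that is, A and B are subalgebras of the pushout D. -/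
noncomputable section

open FreeAlgebra

/-- A generic cubic element with coefficients `c`. -/
def cub (k : Type) [Field k] {n : ℕ} (c : Fin n → Fin n → Fin n → k) : FreeAlgebra k (Fin n) :=
  ∑ i, ∑ j, ∑ l, c i j l • (FreeAlgebra.ι k i * FreeAlgebra.ι k j * FreeAlgebra.ι k l)

/-- The inclusion `k⟨x1,x2,x3⟩ → k⟨x1,x2,x3,x4⟩` (generators `0,1,2` of the
source are `x1,x2,x3`). -/
def inclA (k : Type) [Field k] : FreeAlgebra k (Fin 3) →ₐ[k] FreeAlgebra k (Fin 4) :=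
  FreeAlgebra.lift k fun i => FreeAlgebra.ι k (Fin.castLE (by norm_num) i)

/-- The inclusion `k⟨x1,x2,x4⟩ → k⟨x1,x2,x3,x4⟩` (generators `0,1,2` of the
source are `x1,x2,x4`; the third generator is sent to `x4 = ι 3`). -/
def inclB (k : Type) [Field k] : FreeAlgebra k (Fin 3) →ₐ[k] FreeAlgebra k (Fin 4) :=
  FreeAlgebra.lift k fun i => FreeAlgebra.ι k (![0, 1, 3] i)

/-- The inclusion `k⟨x1,x2⟩ → k⟨x1,x2,x3⟩` (resp. `k⟨x1,x2,x4⟩`). -/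
def inclC (k : Type) [Field k] : FreeAlgebra k (Fin 2) →ₐ[k] FreeAlgebra k (Fin 3) :=
  FreeAlgebra.lift k fun i => FreeAlgebra.ι k (Fin.castLE (by norm_num) i)

section TypeA

variable (k : Type) [Field k]
/- Coefficients of the lower-order parts `f1,…,f8` of a type A presentation,
together with the deg-lex support conditions (`x4 > x3 > x2 > x1`):
in `k⟨x1,x2,x3⟩` the generators are indexed `x1 = 0, x2 = 1, x3 = 2`, in
`k⟨x1,x2,x4⟩` they are indexed `x1 = 0, x2 = 1, x4 = 2`, and in `k⟨x1,x2⟩`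
they are indexed `x1 = 0, x2 = 1`; the index order agrees with the variable
order, so a quadratic word `x_i x_j` is smaller than `x_{i'} x_{j'}` exactly
when `(i,j) < (i',j')` lexicographically, and similarly for cubic words. -/
variable (c1 c2 c3 c4 c5 c6 : Fin 3 → Fin 3 → k)
variable (c7 c8 : Fin 2 → Fin 2 → Fin 2 → k)

/-- `r1 = x3x3 − f1`, `f1` with monomials `< x3x3`. -/
def rA1 : FreeAlgebra k (Fin 3) := FreeAlgebra.ι k 2 * FreeAlgebra.ι k 2 - quad k c1
/-- `r2 = x3x1 − f2`, `f2` with monomials `< x3x1`. -/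
def rA2 : FreeAlgebra k (Fin 3) := FreeAlgebra.ι k 2 * FreeAlgebra.ι k 0 - quad k c2
/-- `r3 = x3x2 − f3`, `f3` with monomials `< x3x2`. -/
def rA3 : FreeAlgebra k (Fin 3) := FreeAlgebra.ι k 2 * FreeAlgebra.ι k 1 - quad k c3
/-- `r4 = x4x1 − f4`, `f4` with monomials `< x4x1`. -/
def rB4 : FreeAlgebra k (Fin 3) := FreeAlgebra.ι k 2 * FreeAlgebra.ι k 0 - quad k c4
/-- `r5 = x4x2 − f5`, `f5` with monomials `< x4x2`. -/
def rB5 : FreeAlgebra k (Fin 3) := FreeAlgebra.ι k 2 * FreeAlgebra.ι k 1 - quad k c5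
/-- `r6 = x4x4 − f6`, `f6` with monomials `< x4x4`. -/
def rB6 : FreeAlgebra k (Fin 3) := FreeAlgebra.ι k 2 * FreeAlgebra.ι k 2 - quad k c6
/-- `r7 = x2x2x1 − f7`, `f7` with monomials `< x2x2x1`. -/
def rC7 : FreeAlgebra k (Fin 2) :=
  FreeAlgebra.ι k 1 * FreeAlgebra.ι k 1 * FreeAlgebra.ι k 0 - cub k c7
/-- `r8 = x2x1x1 − f8`, `f8` with monomials `< x2x1x1`. -/
def rC8 : FreeAlgebra k (Fin 2) :=
  FreeAlgebra.ι k 1 * FreeAlgebra.ι k 0 * FreeAlgebra.ι k 0 - cub k c8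

/-- The relations of the algebra `A = k⟨x1,x2,x3⟩/(r1,r2,r3)`. -/
def setA : Set (FreeAlgebra k (Fin 3)) := {rA1 k c1, rA2 k c2, rA3 k c3}
/-- The relations of the algebra `B = k⟨x1,x2,x4⟩/(r4,r5,r6)`. -/
def setB : Set (FreeAlgebra k (Fin 3)) := {rB4 k c4, rB5 k c5, rB6 k c6}
/-- The relations of the pushout `D = k⟨x1,x2,x3,x4⟩/(r1,…,r6)`. -/
def setD : Set (FreeAlgebra k (Fin 4)) :=
  {inclA k (rA1 k c1), inclA k (rA2 k c2), inclA k (rA3 k c3),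
   inclB k (rB4 k c4), inclB k (rB5 k c5), inclB k (rB6 k c6)}

end TypeA

section NormalWords

variable {k R : Type} [Field k] [Ring R] [Algebra k R]

/-- The word `x₀ᵃ (x₁x₀)ᵇ x₁ᶜ`. -/
def normalWord (x : Fin 2 → R) (a b c : ℕ) : R := x 0 ^ a * (x 1 * x 0) ^ b * x 1 ^ c

/-- The span of the words `x₀ᵃ (x₁x₀)ᵇ x₁ᶜ` of length `n`. -/
def normalSpan (k : Type) {R : Type} [Field k] [Ring R] [Algebra k R] (x : Fin 2 → R) (n : ℕ) :
    Submodule k R :=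
  Submodule.span k {z | ∃ a b c, a + 2 * b + c = n ∧ z = normalWord x a b c}

lemma normalWord_mem (x : Fin 2 → R) {a b c n : ℕ} (h : a + 2 * b + c = n) :
    normalWord x a b c ∈ normalSpan k x n :=
  Submodule.subset_span ⟨a, b, c, h, rfl⟩

lemma mul_normalSpan_le {x : Fin 2 → R} {n : ℕ} {P : Submodule k R} {r : R}
    (h : ∀ a b c, a + 2 * b + c = n → r * normalWord x a b c ∈ P) {z : R}
    (hz : z ∈ normalSpan k x n) : r * z ∈ P := by
  have : normalSpan k x n ≤ P.comap (LinearMap.mulLeft k r) := by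
    refine Submodule.span_le.2 ?_
    rintro _ ⟨a, b, c, h', rfl⟩
    exact h a b c h'
  exact this hz

lemma zero_mul_mem_normalSpan (x : Fin 2 → R) {n : ℕ} {z : R} (hz : z ∈ normalSpan k x n) :
    x 0 * z ∈ normalSpan k x (n + 1) := by
  refine mul_normalSpan_le (fun a b c h => ?_) hz
  have : x 0 * normalWord x a b c = normalWord x (a + 1) b c := by
    simp only [normalWord, pow_succ', mul_assoc]
  rw [this]
  exact normalWord_mem x (by omega)

lemma one_mul_mem_normalSpan {x : Fin 2 → R} {c7 c8 : Fin 2 → Fin 2 → Fin 2 → k}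
    (h7 : ∀ i j l : Fin 2, c7 i j l ≠ 0 → i = 0 ∨ (i = 1 ∧ j = 0))
    (h8 : ∀ i j l : Fin 2, c8 i j l ≠ 0 → i = 0)
    (r7 : x 1 * x 1 * x 0 = ∑ i, ∑ j, ∑ l, c7 i j l • (x i * x j * x l))
    (r8 : x 1 * x 0 * x 0 = ∑ i, ∑ j, ∑ l, c8 i j l • (x i * x j * x l))
    (n : ℕ) : ∀ z ∈ normalSpan k x n, x 1 * z ∈ normalSpan k x (n + 1) := by
  induction n using Nat.strong_induction_on with
  | _ n ih =>
  have step : ∀ m < n, ∀ i, ∀ z ∈ normalSpan k x m, x i * z ∈ normalSpan k x (m + 1) := by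
    intro m hm i z hz
    fin_cases i
    · exact zero_mul_mem_normalSpan x hz
    · exact ih m hm z hz
  have two : ∀ m, m + 2 = n → ∀ j l, ∀ y ∈ normalSpan k x m,
      x 0 * x j * x l * y ∈ normalSpan k x (n + 1) := by
    rintro m rfl j l y hy
    rw [mul_assoc, mul_assoc]
    exact zero_mul_mem_normalSpan x (step _ (by omega) j _ (step _ (by omega) l _ hy))
  have e8 : ∀ m, m + 2 = n → ∀ y ∈ normalSpan k x m,
      x 1 * x 0 * x 0 * y ∈ normalSpan k x (n + 1) := by
    intro m hm y hy
    rw [r8]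
    simp only [Finset.sum_mul, smul_mul_assoc]
    refine sum_mem fun i _ => sum_mem fun j _ => sum_mem fun l _ => ?_
    by_cases hc : c8 i j l = 0
    · simp [hc]
    · obtain rfl := h8 i j l hc
      exact Submodule.smul_mem _ _ (two m hm j l y hy)
  have e10 : ∀ m, m + 1 = n → ∀ y ∈ normalSpan k x m,
      x 1 * x 0 * y ∈ normalSpan k x (n + 1) := by
    intro m hm y hy
    refine mul_normalSpan_le (fun a b c h => ?_) hy
    rcases a with _ | a
    · have : x 1 * x 0 * normalWord x 0 b c = normalWord x 0 (b + 1) c := by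
        simp only [normalWord, pow_succ' _ b, pow_zero, one_mul, mul_assoc]
      rw [this]
      exact normalWord_mem x (by omega)
    · have : x 1 * x 0 * normalWord x (a + 1) b c = x 1 * x 0 * x 0 * normalWord x a b c := by
        simp only [normalWord, pow_succ' _ a, mul_assoc]
      rw [this]
      exact e8 (a + 2 * b + c) (by omega) _ (normalWord_mem x rfl)
  have e7 : ∀ m, m + 2 = n → ∀ y ∈ normalSpan k x m,
      x 1 * x 1 * x 0 * y ∈ normalSpan k x (n + 1) := by
    intro m hm y hy
    rw [r7]
    simp only [Finset.sum_mul, smul_mul_assoc]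
    refine sum_mem fun i _ => sum_mem fun j _ => sum_mem fun l _ => ?_
    by_cases hc : c7 i j l = 0
    · simp [hc]
    · refine Submodule.smul_mem _ _ ?_
      rcases h7 i j l hc with rfl | ⟨rfl, rfl⟩
      · exact two m hm j l y hy
      · rw [mul_assoc]
        exact e10 (m + 1) (by omega) _ (step m (by omega) l y hy)
  intro z hz
  refine mul_normalSpan_le (fun a b c h => ?_) hz
  rcases a with _ | _ | a
  · rcases b with _ | b
    · have : x 1 * normalWord x 0 0 c = normalWord x 0 0 (c + 1) := by
        simp only [normalWord, pow_succ', pow_zero, one_mul]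
      rw [this]
      exact normalWord_mem x (by omega)
    · have : x 1 * normalWord x 0 (b + 1) c = x 1 * x 1 * x 0 * normalWord x 0 b c := by
        simp only [normalWord, pow_succ' _ b, pow_zero, one_mul, mul_assoc]
      rw [this]
      exact e7 (2 * b + c) (by omega) _ (normalWord_mem x (by omega))
  · have : x 1 * normalWord x (0 + 1) b c = normalWord x 0 (b + 1) c := by
      simp only [normalWord, pow_succ' _ b, pow_zero, zero_add, pow_one, one_mul, mul_assoc]
    rw [this]
    exact normalWord_mem x (by omega)
  · have : x 1 * normalWord x (a + 1 + 1) b c = x 1 * x 0 * x 0 * normalWord x a b c := by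
      simp only [normalWord, pow_succ' _ a, pow_succ' _ (a + 1), mul_assoc]
    rw [this]
    exact e8 (a + 2 * b + c) (by omega) _ (normalWord_mem x rfl)

end NormalWords

section Generation

variable {k R : Type} [Field k] [Ring R] [Algebra k R]

lemma mul_mem_of_ι_mul_mem {X : Type} (f : FreeAlgebra k X →ₐ[k] R) {P : Submodule k R}
    (hP : ∀ i, ∀ z ∈ P, f (FreeAlgebra.ι k i) * z ∈ P) (a : FreeAlgebra k X) :
    ∀ z ∈ P, f a * z ∈ P := by
  induction a with
  | grade0 r =>
    intro z hz
    rw [AlgHom.commutes, ← Algebra.smul_def]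
    exact P.smul_mem r hz
  | grade1 i => exact hP i
  | mul a b ha hb =>
    intro z hz
    rw [map_mul, mul_assoc]
    exact ha _ (hb _ hz)
  | add a b ha hb =>
    intro z hz
    rw [map_add, add_mul]
    exact P.add_mem (ha _ hz) (hb _ hz)

lemma eq_top_of_ι_mul_mem {X : Type} {f : FreeAlgebra k X →ₐ[k] R} (hf : Function.Surjective f)
    {P : Submodule k R} (h1 : (1 : R) ∈ P)
    (hP : ∀ i, ∀ z ∈ P, f (FreeAlgebra.ι k i) * z ∈ P) : P = ⊤ := by
  refine eq_top_iff.2 fun z _ => ?_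
  obtain ⟨a, rfl⟩ := hf z
  simpa using mul_mem_of_ι_mul_mem f hP a 1 h1

lemma map_quad {n : ℕ} (f : FreeAlgebra k (Fin n) →ₐ[k] R) (c : Fin n → Fin n → k) :
    f (quad k c) =
      ∑ i, ∑ j, c i j • (f (FreeAlgebra.ι k i) * f (FreeAlgebra.ι k j)) := by
  simp [quad]

lemma map_cub {n : ℕ} (f : FreeAlgebra k (Fin n) →ₐ[k] R) (c : Fin n → Fin n → Fin n → k) :
    f (cub k c) = ∑ i, ∑ j, ∑ l, c i j l •
      (f (FreeAlgebra.ι k i) * f (FreeAlgebra.ι k j) * f (FreeAlgebra.ι k l)) := by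
  simp [cub]

lemma mkAlgHom_eq_zero {n : ℕ} {s : Set (FreeAlgebra k (Fin n))} {r : FreeAlgebra k (Fin n)}
    (h : r ∈ s) : RingQuot.mkAlgHom k (genRel s) r = 0 := by
  rw [RingQuot.mkAlgHom_rel k (show genRel s r 0 from ⟨h, rfl⟩), map_zero]

/-- The homomorphism out of the quotient by `s` induced by one that kills `s`. -/
def quotLift {R : Type} [Semiring R] [Algebra k R] {n : ℕ} {s : Set (FreeAlgebra k (Fin n))} (f : FreeAlgebra k (Fin n) →ₐ[k] R)
    (hf : ∀ r ∈ s, f r = 0) : RingQuot (genRel s) →ₐ[k] R :=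
  RingQuot.liftAlgHom k ⟨f, by rintro x _ ⟨hx, rfl⟩; rw [hf x hx, map_zero]⟩

lemma quotLift_mk {R : Type} [Semiring R] [Algebra k R] {n : ℕ} {s : Set (FreeAlgebra k (Fin n))} (f : FreeAlgebra k (Fin n) →ₐ[k] R)
    (hf : ∀ r ∈ s, f r = 0) (x : FreeAlgebra k (Fin n)) :
    quotLift f hf (RingQuot.mkAlgHom k (genRel s) x) = f x :=
  RingQuot.liftAlgHom_mkAlgHom_apply ..

end Generation

section Grading

open Polynomial

variable {k : Type} [Field k] {n : ℕ}

lemma ι_mem_degF (i : Fin n) : FreeAlgebra.ι k i ∈ degF k n 1 := by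
  rw [degF, pow_one]
  exact Submodule.subset_span ⟨i, rfl⟩

lemma mul_mem_degF {a b : FreeAlgebra k (Fin n)} {p q : ℕ} (ha : a ∈ degF k n p)
    (hb : b ∈ degF k n q) : a * b ∈ degF k n (p + q) := by
  rw [degF, pow_add]
  exact Submodule.mul_mem_mul ha hb

lemma pow_mem_degF {a : FreeAlgebra k (Fin n)} {p : ℕ} (ha : a ∈ degF k n p) (q : ℕ) :
    a ^ q ∈ degF k n (p * q) := by
  rw [degF, pow_mul]
  exact Submodule.pow_mem_pow _ ha q

lemma quad_mem_degF (c : Fin n → Fin n → k) : quad k c ∈ degF k n 2 :=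
  sum_mem fun i _ => sum_mem fun j _ =>
    Submodule.smul_mem _ _ (mul_mem_degF (ι_mem_degF i) (ι_mem_degF j))

/-- The homomorphism from the free algebra to polynomials over a quotient of it that records
the degree. -/
def freeGrade (s : Set (FreeAlgebra k (Fin n))) :
    FreeAlgebra k (Fin n) →ₐ[k] (RingQuot (genRel s))[X] :=
  FreeAlgebra.lift k fun i => C (RingQuot.mkAlgHom k (genRel s) (FreeAlgebra.ι k i)) * X

lemma freeGrade_apply (s : Set (FreeAlgebra k (Fin n))) {m : ℕ} {a : FreeAlgebra k (Fin n)}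
    (ha : a ∈ degF k n m) :
    freeGrade s a = C (RingQuot.mkAlgHom k (genRel s) a) * X ^ m := by
  rw [degF] at ha
  induction ha using Submodule.pow_induction_on_left' with
  | algebraMap r => simp [Polynomial.algebraMap_apply]
  | add x y i _ _ hx hy => simp [hx, hy, add_mul]
  | mem_mul v hv i x _ hx =>
    have hv' : freeGrade s v = C (RingQuot.mkAlgHom k (genRel s) v) * X := by
      induction hv using Submodule.span_induction with
      | mem _ h => obtain ⟨j, rfl⟩ := h; simp [freeGrade]
      | zero => simp
      | add _ _ _ _ h h' => simp [h, h', add_mul]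
      | smul r _ _ h => simp [h, ← Polynomial.smul_C]
    rw [map_mul, hv', hx, map_mul, C_mul, mul_assoc, mul_assoc, ← mul_assoc X, X_mul_C, pow_succ']
    simp only [mul_assoc]

/-- Projections onto the graded components of a quotient by quadratic relations. -/
lemma exists_degQ_proj {s : Set (FreeAlgebra k (Fin n))} (hs : ∀ r ∈ s, r ∈ degF k n 2) :
    ∃ π : ℕ → RingQuot (genRel s) →ₗ[k] RingQuot (genRel s),
      ∀ m p, ∀ a ∈ degQ k s m, π p a = if p = m then a else 0 := by
  have hψ : ∀ r ∈ s, freeGrade s r = 0 := fun r hr => by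
    rw [freeGrade_apply s (hs r hr), mkAlgHom_eq_zero hr, C_0, zero_mul]
  refine ⟨fun p => (Polynomial.lcoeff (RingQuot (genRel s)) p).restrictScalars k ∘ₗ
    (quotLift (freeGrade s) hψ).toLinearMap, ?_⟩
  rintro m p _ ⟨a, ha, rfl⟩
  simp [quotLift_mk, freeGrade_apply s ha]

end Grading

section Independence

variable {k M ι : Type} [Field k] [AddCommGroup M] [Module k M]

lemma linearIndependent_of_graded_span (N : ℕ → Submodule k M) (π : ℕ → M →ₗ[k] M)
    (hπ : ∀ m p, ∀ a ∈ N m, π p a = if p = m then a else 0) (d : ι → ℕ) (v : ι → M)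
    (hv : ∀ i, v i ∈ N (d i)) (hspan : Submodule.span k (Set.range v) = ⊤)
    (T : ℕ → Finset ι) (hT : ∀ n i, i ∈ T n ↔ d i = n)
    (hcard : ∀ n, (T n).card ≤ Module.finrank k (N n)) : LinearIndependent k v := by
  classical
  have hπv : ∀ n i, π n (v i) = if i ∈ T n then v i else 0 := by
    intro n i
    rw [hπ _ n _ (hv i)]
    simp only [hT, eq_comm]
  have hN : ∀ n, N n ≤ Submodule.span k (Set.range fun i : T n => v i) := by
    intro n a ha
    have : (⊤ : Submodule k M) ≤
        (Submodule.span k (Set.range fun i : T n => v i)).comap (π n) := by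
      rw [← hspan, Submodule.span_le]
      rintro _ ⟨i, rfl⟩
      simp only [Submodule.comap_coe, Set.mem_preimage, SetLike.mem_coe, hπv]
      split_ifs with h
      · exact Submodule.subset_span ⟨⟨i, h⟩, rfl⟩
      · exact zero_mem _
    simpa [hπ n n a ha] using this (Submodule.mem_top (x := a))
  have hT' : ∀ n, LinearIndependent k fun i : T n => v i := by
    intro n
    rw [linearIndependent_iff_card_le_finrank_span, Fintype.card_coe]
    have := FiniteDimensional.span_of_finite k (Set.finite_range fun i : T n => v i)
    exact (hcard n).trans (Submodule.finrank_mono (hN n))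
  rw [linearIndependent_iff']
  intro S g hg i hi
  have h1 : ∑ j ∈ S, g j • π (d i) (v j) = 0 := by
    rw [← map_zero (π (d i)), ← hg, map_sum]
    simp
  simp only [hπv, smul_ite, smul_zero] at h1
  have h2 : ∑ j : T (d i), (if (j : ι) ∈ S then g j else 0) • v j = 0 := by
    rw [← h1, Finset.sum_coe_sort (T (d i)) fun j => (if j ∈ S then g j else 0) • v j,
      ← Finset.sum_filter]
    simp only [ite_smul, zero_smul]
    rw [← Finset.sum_filter, Finset.filter_mem_eq_inter, Finset.filter_mem_eq_inter,
      Finset.inter_comm]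
  have h3 := Fintype.linearIndependent_iff.1 (hT' (d i)) _ h2 ⟨i, (hT _ _).2 rfl⟩
  simpa [hi] using h3

lemma injective_of_linearIndependent_comp {M' : Type} [AddCommGroup M'] [Module k M']
    (f : M →ₗ[k] M') (u : ι → M) (hu : Submodule.span k (Set.range u) = ⊤)
    (hfu : LinearIndependent k (f ∘ u)) : Function.Injective f := by
  rw [injective_iff_map_eq_zero]
  intro z hz
  have hz' : z ∈ Submodule.span k (Set.range u) := hu ▸ Submodule.mem_top
  obtain ⟨c, rfl⟩ := Finsupp.mem_span_range_iff_exists_finsupp.1 hz'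
  have : Finsupp.linearCombination k (f ∘ u) c = 0 := by
    rw [← hz, map_finsuppSum]
    simp [Finsupp.linearCombination_apply]
  rw [(linearIndependent_iff.1 hfu) c this]
  simp

/-- The triples of natural numbers with sum `n`. -/
def triples (n : ℕ) : Finset (ℕ × ℕ × ℕ) :=
  ((Finset.HasAntidiagonal.antidiagonal n).sigma fun p =>
    Finset.HasAntidiagonal.antidiagonal p.2).image
    fun s => (s.1.1, s.2.1, s.2.2)

lemma mem_triples (n : ℕ) (t : ℕ × ℕ × ℕ) : t ∈ triples n ↔ t.1 + t.2.1 + t.2.2 = n := by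
  obtain ⟨a, b, c⟩ := t
  simp only [triples, Finset.mem_image, Finset.mem_sigma, Finset.HasAntidiagonal.mem_antidiagonal, Prod.mk.injEq]
  constructor
  · rintro ⟨⟨⟨p, q⟩, ⟨r, s⟩⟩, ⟨h, h'⟩, rfl, rfl, rfl⟩
    dsimp only at *
    omega
  · intro h
    exact ⟨⟨(a, b + c), (b, c)⟩, ⟨by dsimp only; omega, rfl⟩, rfl, rfl, rfl⟩

lemma card_triples_le (n : ℕ) : (triples n).card ≤ (n + 2).choose 2 := by
  refine Finset.card_image_le.trans (le_of_eq ?_)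
  rw [Finset.card_sigma]
  simp only [Finset.Nat.card_antidiagonal]
  induction n with
  | zero => simp
  | succ n ih =>
    rw [Finset.Nat.sum_antidiagonal_succ, ih, Nat.choose_succ_succ' (n + 2) 1, Nat.choose_one_right]

end Independence

section Decomposition

variable {k : Type} [Field k]

/-- The relations of `C`. -/
def setC (k : Type) [Field k] (c7 c8 : Fin 2 → Fin 2 → Fin 2 → k) :
    Set (FreeAlgebra k (Fin 2)) := {rC7 k c7, rC8 k c8}

/-- The map `(p, q) ↦ α p + α q * y`. -/
def pairMap {S R : Type} [Ring S] [Algebra k S] [Ring R] [Algebra k R] (α : S →ₐ[k] R) (y : R) :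
    S × S →ₗ[k] R :=
  α.toLinearMap.coprod (LinearMap.mulRight k y ∘ₗ α.toLinearMap)

lemma pairMap_apply {S R : Type} [Ring S] [Algebra k S] [Ring R] [Algebra k R] (α : S →ₐ[k] R)
    (y : R) (p : S × S) : pairMap α y p = α p.1 + α p.2 * y := rfl

lemma pairMap_smul {S R : Type} [Ring S] [Algebra k S] [Ring R] [Algebra k R] (α : S →ₐ[k] R)
    (y : R) (s : S) (p : S × S) : pairMap α y (s * p.1, s * p.2) = α s * pairMap α y p := by
  simp [pairMap_apply, mul_add, mul_assoc]

variable {c7 c8 : Fin 2 → Fin 2 → Fin 2 → k}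

lemma span_normalWord_eq_top (h7 : ∀ i j l : Fin 2, c7 i j l ≠ 0 → i = 0 ∨ (i = 1 ∧ j = 0))
    (h8 : ∀ i j l : Fin 2, c8 i j l ≠ 0 → i = 0) :
    Submodule.span k (Set.range fun t : ℕ × ℕ × ℕ => normalWord
      (fun i => RingQuot.mkAlgHom k (genRel (setC k c7 c8)) (FreeAlgebra.ι k i))
      t.1 t.2.1 t.2.2) = ⊤ := by
  set mk := RingQuot.mkAlgHom k (genRel (setC k c7 c8))
  set x : Fin 2 → RingQuot (genRel (setC k c7 c8)) := fun i => mk (FreeAlgebra.ι k i)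
  have r7 : x 1 * x 1 * x 0 = ∑ i, ∑ j, ∑ l, c7 i j l • (x i * x j * x l) := by
    have : mk (rC7 k c7) = 0 := mkAlgHom_eq_zero (by simp [setC])
    rw [rC7, map_sub, sub_eq_zero, map_cub] at this
    simpa using this
  have r8 : x 1 * x 0 * x 0 = ∑ i, ∑ j, ∑ l, c8 i j l • (x i * x j * x l) := by
    have : mk (rC8 k c8) = 0 := mkAlgHom_eq_zero (by simp [setC])
    rw [rC8, map_sub, sub_eq_zero, map_cub] at this
    simpa using this
  have hle : ∀ n, normalSpan k x n ≤ Submodule.span k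
      (Set.range fun t : ℕ × ℕ × ℕ => normalWord x t.1 t.2.1 t.2.2) := by
    refine fun n => Submodule.span_mono ?_
    rintro _ ⟨a, b, c, -, rfl⟩
    exact ⟨(a, b, c), rfl⟩
  refine eq_top_of_ι_mul_mem (RingQuot.mkAlgHom_surjective k _)
    (Submodule.subset_span ⟨(0, 0, 0), by simp [normalWord]⟩) fun i z hz => ?_
  induction hz using Submodule.span_induction with
  | mem _ h =>
    obtain ⟨⟨a, b, c⟩, rfl⟩ := h
    have hw : normalWord x a b c ∈ normalSpan k x (a + 2 * b + c) := normalWord_mem x rfl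
    fin_cases i
    · exact hle _ (zero_mul_mem_normalSpan x hw)
    · exact hle _ (one_mul_mem_normalSpan h7 h8 r7 r8 _ _ hw)
  | zero => simp
  | add _ _ _ _ h h' => rw [mul_add]; exact add_mem h h'
  | smul r _ _ h => rw [mul_smul_comm]; exact Submodule.smul_mem _ r h

variable {c1 c2 c3 : Fin 3 → Fin 3 → k}

lemma pairMap_surjective {S R : Type} [Ring S] [Algebra k S] [Ring R] [Algebra k R]
    (f : FreeAlgebra k (Fin 3) →ₐ[k] R) (hf : Function.Surjective f)
    (h1 : ∀ i j : Fin 3, c1 i j ≠ 0 → i < 2 ∨ (i = 2 ∧ j < 2))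
    (h2 : ∀ i j : Fin 3, c2 i j ≠ 0 → i < 2)
    (h3 : ∀ i j : Fin 3, c3 i j ≠ 0 → i < 2 ∨ (i = 2 ∧ j = 0))
    (r1 : f (rA1 k c1) = 0) (r2 : f (rA2 k c2) = 0) (r3 : f (rA3 k c3) = 0)
    (α : S →ₐ[k] R) (g : FreeAlgebra k (Fin 2) →ₐ[k] S) (hg : Function.Surjective g)
    (hα : ∀ z, α (g z) = f (inclC k z)) :
    Function.Surjective (pairMap α (f (FreeAlgebra.ι k 2))) := by
  set x : Fin 3 → R := fun i => f (FreeAlgebra.ι k i) with hx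
  set P := LinearMap.range (pairMap α (x 2))
  have e1 : x 2 * x 2 = ∑ i, ∑ j, c1 i j • (x i * x j) := by
    rw [rA1, map_sub, sub_eq_zero, map_quad] at r1
    simpa using r1
  have e2 : x 2 * x 0 = ∑ i, ∑ j, c2 i j • (x i * x j) := by
    rw [rA2, map_sub, sub_eq_zero, map_quad] at r2
    simpa using r2
  have e3 : x 2 * x 1 = ∑ i, ∑ j, c3 i j • (x i * x j) := by
    rw [rA3, map_sub, sub_eq_zero, map_quad] at r3
    simpa using r3
  have hx0 : x 0 = α (g (FreeAlgebra.ι k 0)) := by simp [hα, inclC, hx]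
  have hx1 : x 1 = α (g (FreeAlgebra.ι k 1)) := by simp [hα, inclC, hx]
  have hC : ∀ s, ∀ z ∈ P, α s * z ∈ P := by
    rintro s _ ⟨p, rfl⟩
    exact ⟨_, pairMap_smul α (x 2) s p⟩
  have hlt : ∀ i : Fin 3, i < 2 → ∀ z ∈ P, x i * z ∈ P := by
    intro i hi z hz
    have : i = 0 ∨ i = 1 := by omega
    rcases this with rfl | rfl
    · rw [hx0]; exact hC _ _ hz
    · rw [hx1]; exact hC _ _ hz
  have hone : (1 : R) ∈ P := ⟨(1, 0), by simp [pairMap_apply]⟩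
  have htwo : x 2 ∈ P := ⟨(0, 1), by simp [pairMap_apply]⟩
  have hxP : ∀ j, x j ∈ P := by
    intro j
    by_cases hj : j < 2
    · simpa using hlt j hj 1 hone
    · obtain rfl : j = 2 := by omega
      exact htwo
  have key0 : ∀ y ∈ P, x 2 * y ∈ P → x 2 * (x 0 * y) ∈ P := by
    intro y hy hy2
    rw [← mul_assoc, e2]
    simp only [Finset.sum_mul, smul_mul_assoc]
    refine sum_mem fun i _ => sum_mem fun j _ => ?_
    by_cases hc : c2 i j = 0
    · simp [hc]
    refine P.smul_mem _ ?_
    rw [mul_assoc]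
    refine hlt i (h2 i j hc) _ ?_
    by_cases hj : j < 2
    · exact hlt j hj y hy
    · obtain rfl : j = 2 := by omega
      exact hy2
  have key1 : ∀ y ∈ P, x 2 * y ∈ P → x 2 * (x 1 * y) ∈ P := by
    intro y hy hy2
    rw [← mul_assoc, e3]
    simp only [Finset.sum_mul, smul_mul_assoc]
    refine sum_mem fun i _ => sum_mem fun j _ => ?_
    by_cases hc : c3 i j = 0
    · simp [hc]
    refine P.smul_mem _ ?_
    rw [mul_assoc]
    rcases h3 i j hc with hi | ⟨rfl, rfl⟩
    · refine hlt i hi _ ?_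
      by_cases hj : j < 2
      · exact hlt j hj y hy
      · obtain rfl : j = 2 := by omega
        exact hy2
    · exact key0 y hy hy2
  have h22 : x 2 * x 2 ∈ P := by
    rw [e1]
    refine sum_mem fun i _ => sum_mem fun j _ => ?_
    by_cases hc : c1 i j = 0
    · simp [hc]
    refine P.smul_mem _ ?_
    rcases h1 i j hc with hi | ⟨rfl, hj⟩
    · exact hlt i hi _ (hxP j)
    · have : j = 0 ∨ j = 1 := by omega
      rcases this with rfl | rfl
      · simpa using key0 1 hone (by simpa using htwo)
      · simpa using key1 1 hone (by simpa using htwo)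
  have hQ : ∀ a : FreeAlgebra k (Fin 2), ∀ z ∈ P ⊓ P.comap (LinearMap.mulLeft k (x 2)),
      (α.comp g) a * z ∈ P ⊓ P.comap (LinearMap.mulLeft k (x 2)) := by
    refine mul_mem_of_ι_mul_mem (α.comp g) fun i z hz => ?_
    obtain ⟨hz1, hz2⟩ := hz
    refine ⟨hC _ _ hz1, ?_⟩
    fin_cases i
    · have := key0 z hz1 hz2
      rw [hx0] at this
      exact this
    · have := key1 z hz1 hz2
      rw [hx1] at this
      exact this
  have hx2P : ∀ z ∈ P, x 2 * z ∈ P := by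
    rintro _ ⟨⟨p, q⟩, rfl⟩
    obtain ⟨p, rfl⟩ := hg p
    obtain ⟨q, rfl⟩ := hg q
    rw [pairMap_apply, mul_add]
    have hp := (hQ p 1 ⟨hone, by simpa using htwo⟩).2
    have hq := (hQ q (x 2) ⟨htwo, by simpa using h22⟩).2
    refine P.add_mem ?_ hq
    simpa using hp
  refine LinearMap.range_eq_top.1 (eq_top_of_ι_mul_mem hf hone fun i z hz => ?_)
  by_cases hi : i < 2
  · exact hlt i hi z hz
  · obtain rfl : i = 2 := by omega
    exact hx2P z hz

/-- Basis words of `S × S`, indexed so that `(a, m, c)` has degree `a + m + c`. -/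
def pairWord {S : Type} [Ring S] (x : Fin 2 → S) (t : ℕ × ℕ × ℕ) : S × S :=
  if t.2.1 % 2 = 0 then (normalWord x t.1 (t.2.1 / 2) t.2.2, 0)
  else (0, normalWord x t.1 (t.2.1 / 2) t.2.2)

lemma span_pairWord_eq_top {S : Type} [Ring S] [Algebra k S] {x : Fin 2 → S}
    (h : Submodule.span k (Set.range fun t : ℕ × ℕ × ℕ => normalWord x t.1 t.2.1 t.2.2) = ⊤) :
    Submodule.span k (Set.range (pairWord x)) = ⊤ := by
  set Q := Submodule.span k (Set.range (pairWord x))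
  have hl : (⊤ : Submodule k S) ≤ Q.comap (LinearMap.inl k S S) := by
    rw [← h, Submodule.span_le]
    rintro _ ⟨⟨a, b, c⟩, rfl⟩
    exact Submodule.subset_span ⟨(a, 2 * b, c), by simp [pairWord]⟩
  have hr : (⊤ : Submodule k S) ≤ Q.comap (LinearMap.inr k S S) := by
    rw [← h, Submodule.span_le]
    rintro _ ⟨⟨a, b, c⟩, rfl⟩
    refine Submodule.subset_span ⟨(a, 2 * b + 1, c), ?_⟩
    have h1 : (2 * b + 1) / 2 = b := by omega
    simp [pairWord, h1, Nat.add_mod]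
  refine eq_top_iff.2 fun p _ => ?_
  have := Q.add_mem (hl (Submodule.mem_top (x := p.1))) (hr (Submodule.mem_top (x := p.2)))
  simpa using this

/-- `A` is a free left `C`-module on `1` and its last generator. -/
lemma pairMap_bijective {s : Set (FreeAlgebra k (Fin 3))} (hs : s = setA k c1 c2 c3)
    (h1 : ∀ i j : Fin 3, c1 i j ≠ 0 → i < 2 ∨ (i = 2 ∧ j < 2))
    (h2 : ∀ i j : Fin 3, c2 i j ≠ 0 → i < 2)
    (h3 : ∀ i j : Fin 3, c3 i j ≠ 0 → i < 2 ∨ (i = 2 ∧ j = 0))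
    (h7 : ∀ i j l : Fin 2, c7 i j l ≠ 0 → i = 0 ∨ (i = 1 ∧ j = 0))
    (h8 : ∀ i j l : Fin 2, c8 i j l ≠ 0 → i = 0)
    (hdim : ∀ n : ℕ, Module.finrank k (degQ k s n) = (n + 2).choose 2)
    (α : RingQuot (genRel (setC k c7 c8)) →ₐ[k] RingQuot (genRel s))
    (hα : ∀ z, α (RingQuot.mkAlgHom k (genRel (setC k c7 c8)) z) =
      RingQuot.mkAlgHom k (genRel s) (inclC k z)) :
    Function.Bijective
      (pairMap α (RingQuot.mkAlgHom k (genRel s) (FreeAlgebra.ι k 2))) := by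
  have hsurj : Function.Surjective
      (pairMap α (RingQuot.mkAlgHom k (genRel s) (FreeAlgebra.ι k 2))) :=
    pairMap_surjective _ (RingQuot.mkAlgHom_surjective k _) h1 h2 h3
      (mkAlgHom_eq_zero (by simp [hs, setA])) (mkAlgHom_eq_zero (by simp [hs, setA]))
      (mkAlgHom_eq_zero (by simp [hs, setA])) α _ (RingQuot.mkAlgHom_surjective k _) hα
  refine ⟨?_, hsurj⟩
  have hquad : ∀ r ∈ s, r ∈ degF k 3 2 := by
    intro r hr
    simp only [hs, setA, Set.mem_insert_iff, Set.mem_singleton_iff] at hr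
    rcases hr with rfl | rfl | rfl
    all_goals
      exact sub_mem (mul_mem_degF (ι_mem_degF _) (ι_mem_degF _)) (quad_mem_degF _)
  obtain ⟨π, hπ⟩ := exists_degQ_proj hquad
  have hu := span_pairWord_eq_top (span_normalWord_eq_top (k := k) h7 h8)
  refine injective_of_linearIndependent_comp _ _ hu ?_
  refine linearIndependent_of_graded_span (degQ k s) π hπ (fun t => t.1 + t.2.1 + t.2.2) _ ?_ ?_
    triples mem_triples fun n => (card_triples_le n).trans (hdim n).ge
  · rintro ⟨a, m, c⟩
    have hw : ∀ b, α (normalWord (fun i => RingQuot.mkAlgHom k (genRel (setC k c7 c8))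
        (FreeAlgebra.ι k i)) a b c) = RingQuot.mkAlgHom k (genRel s)
          (FreeAlgebra.ι k 0 ^ a * (FreeAlgebra.ι k 1 * FreeAlgebra.ι k 0) ^ b *
            FreeAlgebra.ι k 1 ^ c) := by
      intro b
      simp only [normalWord, ← map_mul, ← map_pow, hα]
      simp [inclC]
    have hdeg : ∀ b, FreeAlgebra.ι k 0 ^ a * (FreeAlgebra.ι k 1 * FreeAlgebra.ι k 0) ^ b *
        FreeAlgebra.ι k 1 ^ c ∈ degF k 3 (1 * a + (1 + 1) * b + 1 * c) := fun b =>
      mul_mem_degF (mul_mem_degF (pow_mem_degF (ι_mem_degF 0) a)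
        (pow_mem_degF (mul_mem_degF (ι_mem_degF 1) (ι_mem_degF 0)) b))
        (pow_mem_degF (ι_mem_degF 1) c)
    rcases Nat.mod_two_eq_zero_or_one m with hm | hm
    · have e : a + m + c = 1 * a + (1 + 1) * (m / 2) + 1 * c := by omega
      simp only [Function.comp_apply, pairWord, hm, if_true, pairMap_apply, map_zero, zero_mul,
        add_zero, hw, e]
      exact Submodule.mem_map_of_mem (hdeg _)
    · have e : a + m + c = 1 * a + (1 + 1) * (m / 2) + 1 * c + 1 := by omega
      simp only [Function.comp_apply, pairWord, hm, one_ne_zero, if_false, pairMap_apply,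
        map_zero, zero_add, hw, ← map_mul, e]
      exact Submodule.mem_map_of_mem (mul_mem_degF (hdeg _) (ι_mem_degF 2))
  · rw [Set.range_comp, Submodule.span_image, hu, Submodule.map_top,
      LinearMap.range_eq_top.2 hsurj]

end Decomposition

section Conjugation

variable {k M R : Type} [Field k] [AddCommGroup M] [Module k M] [Ring R] [Algebra k R]

/-- The left regular representation of `R` transported along `e`. -/
def transportedRep (e : M ≃ₗ[k] R) : R →ₐ[k] Module.End k M :=
  (e.symm.conjAlgEquiv k : Module.End k R →ₐ[k] Module.End k M).comp (Algebra.lmul k R)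

lemma transportedRep_apply (e : M ≃ₗ[k] R) (r : R) (m : M) :
    transportedRep e r m = e.symm (r * e m) := rfl

lemma transportedRep_injective (e : M ≃ₗ[k] R) : Function.Injective (transportedRep e) := by
  intro r s h
  have := LinearMap.congr_fun h (e.symm 1)
  simpa [transportedRep_apply] using this

end Conjugation

/-- with the type A presentation data and hypotheses, the natural
`k`-algebra maps `A → D` and `B → D` (sending generators to generators) are
injective; i.e. `A` and `B` are subalgebras of the pushout `D`. -/
theorem stmt4 (k : Type) [Field k] [IsAlgClosed k] [CharZero k]
    (c1 c2 c3 c4 c5 c6 : Fin 3 → Fin 3 → k)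
    (c7 c8 : Fin 2 → Fin 2 → Fin 2 → k)
    -- deg-lex support conditions on the lower-order parts f1,…,f8
    (h1 : ∀ i j : Fin 3, c1 i j ≠ 0 → i < 2 ∨ (i = 2 ∧ j < 2))
    (h2 : ∀ i j : Fin 3, c2 i j ≠ 0 → i < 2)
    (h3 : ∀ i j : Fin 3, c3 i j ≠ 0 → i < 2 ∨ (i = 2 ∧ j = 0))
    (h4 : ∀ i j : Fin 3, c4 i j ≠ 0 → i < 2)
    (h5 : ∀ i j : Fin 3, c5 i j ≠ 0 → i < 2 ∨ (i = 2 ∧ j = 0))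
    (h6 : ∀ i j : Fin 3, c6 i j ≠ 0 → i < 2 ∨ (i = 2 ∧ j < 2))
    (h7 : ∀ i j l : Fin 2, c7 i j l ≠ 0 → i = 0 ∨ (i = 1 ∧ j = 0))
    (h8 : ∀ i j l : Fin 2, c8 i j l ≠ 0 → i = 0)
    -- A and B have the Hilbert function of a regular quadratic algebra of
    -- global dimension three
    (hAdim : ∀ n : ℕ,
      Module.finrank k (degQ k (setA k c1 c2 c3) n) = (n + 2).choose 2)
    (hBdim : ∀ n : ℕ,
      Module.finrank k (degQ k (setB k c4 c5 c6) n) = (n + 2).choose 2)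
    -- r7 and r8 lie in the defining ideals of A and of B
    (hC7A : RingQuot.mkAlgHom k (genRel (setA k c1 c2 c3)) (inclC k (rC7 k c7)) = 0)
    (hC8A : RingQuot.mkAlgHom k (genRel (setA k c1 c2 c3)) (inclC k (rC8 k c8)) = 0)
    (hC7B : RingQuot.mkAlgHom k (genRel (setB k c4 c5 c6)) (inclC k (rC7 k c7)) = 0)
    (hC8B : RingQuot.mkAlgHom k (genRel (setB k c4 c5 c6)) (inclC k (rC8 k c8)) = 0) :
    (∃ φA : RingQuot (genRel (setA k c1 c2 c3)) →ₐ[k]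
        RingQuot (genRel (setD k c1 c2 c3 c4 c5 c6)),
      (∀ x, φA (RingQuot.mkAlgHom k (genRel (setA k c1 c2 c3)) x) =
        RingQuot.mkAlgHom k (genRel (setD k c1 c2 c3 c4 c5 c6)) (inclA k x)) ∧
      Function.Injective φA) ∧
    (∃ φB : RingQuot (genRel (setB k c4 c5 c6)) →ₐ[k]
        RingQuot (genRel (setD k c1 c2 c3 c4 c5 c6)),
      (∀ x, φB (RingQuot.mkAlgHom k (genRel (setB k c4 c5 c6)) x) =
        RingQuot.mkAlgHom k (genRel (setD k c1 c2 c3 c4 c5 c6)) (inclB k x)) ∧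
      Function.Injective φB) := by
  have hA7 : ∀ r ∈ setC k c7 c8, (RingQuot.mkAlgHom k (genRel (setA k c1 c2 c3))).comp
      (inclC k) r = 0 := by
    rintro r (rfl | rfl)
    exacts [hC7A, hC8A]
  have hB7 : ∀ r ∈ setC k c7 c8, (RingQuot.mkAlgHom k (genRel (setB k c4 c5 c6))).comp
      (inclC k) r = 0 := by
    rintro r (rfl | rfl)
    exacts [hC7B, hC8B]
  have hsB : setB k c4 c5 c6 = setA k c6 c4 c5 := by
    ext r
    simp only [setA, setB, Set.mem_insert_iff, Set.mem_singleton_iff]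
    change _ ∨ _ ∨ r = rA1 k c6 ↔ _ ∨ r = rB4 k c4 ∨ r = rB5 k c5
    tauto
  set mkA := RingQuot.mkAlgHom k (genRel (setA k c1 c2 c3)) with hmkA
  set mkB := RingQuot.mkAlgHom k (genRel (setB k c4 c5 c6)) with hmkB
  have bA := pairMap_bijective rfl h1 h2 h3 h7 h8 hAdim (quotLift _ hA7) (quotLift_mk _ hA7)
  have bB := pairMap_bijective hsB h6 h4 h5 h7 h8 hBdim (quotLift _ hB7) (quotLift_mk _ hB7)
  set eA := LinearEquiv.ofBijective _ bA
  set eB := LinearEquiv.ofBijective _ bB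
  have agree : ∀ z, transportedRep eA (mkA (inclC k z)) =
      transportedRep eB (mkB (inclC k z)) := by
    intro z
    set w := RingQuot.mkAlgHom k (genRel (setC k c7 c8)) z
    refine LinearMap.ext fun p => ?_
    trans (w * p.1, w * p.2)
    · rw [transportedRep_apply, LinearEquiv.symm_apply_eq]
      refine Eq.trans ?_ (pairMap_smul _ _ w p).symm
      rw [quotLift_mk]
      rfl
    · rw [transportedRep_apply, eq_comm, LinearEquiv.symm_apply_eq]
      refine Eq.trans ?_ (pairMap_smul _ _ w p).symm
      rw [quotLift_mk]
      rfl
  have agree0 := agree (FreeAlgebra.ι k 0)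
  have agree1 := agree (FreeAlgebra.ι k 1)
  simp only [inclC, FreeAlgebra.lift_ι_apply] at agree0 agree1
  let F : FreeAlgebra k (Fin 4) →ₐ[k] Module.End k _ := FreeAlgebra.lift k
    ![transportedRep eA (mkA (FreeAlgebra.ι k 0)), transportedRep eA (mkA (FreeAlgebra.ι k 1)),
      transportedRep eA (mkA (FreeAlgebra.ι k 2)), transportedRep eB (mkB (FreeAlgebra.ι k 2))]
  have FA : ∀ z, F (inclA k z) = transportedRep eA (mkA z) := by
    refine fun z => AlgHom.congr_fun (φ₁ := F.comp (inclA k))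
      (φ₂ := (transportedRep eA).comp mkA) ?_ z
    ext i : 2
    fin_cases i <;> simp [F, inclA]
  have FB : ∀ z, F (inclB k z) = transportedRep eB (mkB z) := by
    refine fun z => AlgHom.congr_fun (φ₁ := F.comp (inclB k))
      (φ₂ := (transportedRep eB).comp mkB) ?_ z
    ext i : 2
    fin_cases i
    · simpa [F, inclB] using agree0
    · simpa [F, inclB] using agree1
    · simp [F, inclB]
  have hF : ∀ r ∈ setD k c1 c2 c3 c4 c5 c6, F r = 0 := by
    rintro r (rfl | rfl | rfl | rfl | rfl | rfl)
    iterate 3 rw [FA, hmkA, mkAlgHom_eq_zero (by simp [setA]), map_zero]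
    iterate 3 rw [FB, hmkB, mkAlgHom_eq_zero (by simp [setB]), map_zero]
  have hiA : ∀ r ∈ setA k c1 c2 c3, (RingQuot.mkAlgHom k (genRel
      (setD k c1 c2 c3 c4 c5 c6))).comp (inclA k) r = 0 := by
    rintro r (rfl | rfl | rfl) <;> exact mkAlgHom_eq_zero (by simp [setD])
  have hiB : ∀ r ∈ setB k c4 c5 c6, (RingQuot.mkAlgHom k (genRel
      (setD k c1 c2 c3 c4 c5 c6))).comp (inclB k) r = 0 := by
    rintro r (rfl | rfl | rfl) <;> exact mkAlgHom_eq_zero (by simp [setD])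
  let G : RingQuot (genRel (setD k c1 c2 c3 c4 c5 c6)) →ₐ[k] Module.End k _ := quotLift F hF
  refine ⟨⟨quotLift _ hiA, quotLift_mk _ hiA, ?_⟩, ⟨quotLift _ hiB, quotLift_mk _ hiB, ?_⟩⟩
  · refine Function.Injective.of_comp (f := G) ?_
    convert transportedRep_injective eA using 1
    funext a
    obtain ⟨z, rfl⟩ := RingQuot.mkAlgHom_surjective k _ a
    rw [Function.comp_apply, quotLift_mk, AlgHom.comp_apply]
    exact (quotLift_mk F hF _).trans (FA z)
  · refine Function.Injective.of_comp (f := G) ?_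
    convert transportedRep_injective eB using 1
    funext a
    obtain ⟨z, rfl⟩ := RingQuot.mkAlgHom_surjective k _ a
    rw [Function.comp_apply, quotLift_mk, AlgHom.comp_apply]
    exact (quotLift_mk F hF _).trans (FB z)
end
end

section
/- Let D'' = k⟨x1,x2,x3,x4⟩/(x3^2, x3x2, x3x1, x4^2, x4x2, x4x1, x2x1x2, x2x1^2). Then dim_k D''_4 = 34. (In particular, since a regular algebra of type (14641) must have dim_k of its degree-4 component equal to 35, no pushout algebra whose cubic relations have leading terms x2x1x2 and x2x1^2 can be regular.) -/
noncomputable section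

open FreeAlgebra

/-- The noncommutative monomial attached to a word. -/
def wordMonomial (k : Type) [Field k] {n : ℕ} (l : List (Fin n)) : FreeAlgebra k (Fin n) :=
  (l.map (FreeAlgebra.ι k)).prod

/-- A word avoids `B` if no word of `B` occurs in it as a factor. -/
def AvoidsWords {n : ℕ} (B : List (List (Fin n))) (l : List (Fin n)) : Prop :=
  ∀ b ∈ B, ¬ b <:+: l

instance {n : ℕ} (B : List (List (Fin n))) : DecidablePred (AvoidsWords B) :=
  fun l => inferInstanceAs (Decidable (∀ b ∈ B, ¬ b <:+: l))

section MonomialAlgebra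

variable {k : Type} [Field k] {n : ℕ} (B : List (List (Fin n)))

lemma wordMonomial_cons (i : Fin n) (l : List (Fin n)) :
    wordMonomial k (i :: l) = FreeAlgebra.ι k i * wordMonomial k l := by
  simp [wordMonomial]

lemma wordMonomial_append (l l' : List (Fin n)) :
    wordMonomial k (l ++ l') = wordMonomial k l * wordMonomial k l' := by
  simp [wordMonomial]

variable (k) in
/-- The action of the free algebra on the span of all words by left concatenation, where a
concatenation that creates a prefix in `B` gives zero. -/
def concatAction : FreeAlgebra k (Fin n) →ₐ[k] Module.End k (List (Fin n) →₀ k) :=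
  FreeAlgebra.lift k fun i => Finsupp.linearCombination k fun w =>
    if ∃ b ∈ B, b <+: i :: w then 0 else Finsupp.single (i :: w) 1

lemma concatAction_ι_single (i : Fin n) (w : List (Fin n)) :
    concatAction k B (FreeAlgebra.ι k i) (Finsupp.single w 1) =
      if ∃ b ∈ B, b <+: i :: w then 0 else Finsupp.single (i :: w) 1 := by
  simp [concatAction]

lemma concatAction_wordMonomial_single (l w : List (Fin n)) :
    concatAction k B (wordMonomial k l) (Finsupp.single w 1) = 0 ∨
      concatAction k B (wordMonomial k l) (Finsupp.single w 1) = Finsupp.single (l ++ w) 1 := by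
  induction l with
  | nil => right; simp [wordMonomial]
  | cons i l ih =>
    rw [wordMonomial_cons, map_mul, Module.End.mul_apply]
    rcases ih with h | h
    · left; rw [h, map_zero]
    · rw [h, concatAction_ι_single]
      split_ifs
      · exact Or.inl rfl
      · exact Or.inr rfl

variable {B}

lemma concatAction_wordMonomial_of_mem (hB : [] ∉ B) {b : List (Fin n)} (hb : b ∈ B) :
    concatAction k B (wordMonomial k b) = 0 := by
  cases b with
  | nil => exact absurd hb hB
  | cons i l =>
    refine Finsupp.lhom_ext' fun w => LinearMap.ext_ring ?_
    simp only [LinearMap.comp_apply, Finsupp.lsingle_apply, LinearMap.zero_apply]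
    rw [wordMonomial_cons, map_mul, Module.End.mul_apply]
    rcases concatAction_wordMonomial_single (k := k) B l w with h | h
    · rw [h, map_zero]
    · rw [h, concatAction_ι_single, if_pos ⟨_, hb, by simp⟩]

lemma concatAction_wordMonomial_of_avoids {l : List (Fin n)} (hl : AvoidsWords B l) :
    concatAction k B (wordMonomial k l) (Finsupp.single [] 1) = Finsupp.single l 1 := by
  induction l with
  | nil => simp [wordMonomial]
  | cons i l ih =>
    rw [wordMonomial_cons, map_mul, Module.End.mul_apply,
      ih fun b hb h => hl b hb (h.trans (List.suffix_cons i l).isInfix), concatAction_ι_single,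
      if_neg]
    rintro ⟨b, hb, h⟩
    exact hl b hb h.isInfix

variable {s : Set (FreeAlgebra k (Fin n))}

lemma mkAlgHom_wordMonomial_eq_zero (hs : s = wordMonomial k '' {b | b ∈ B})
    {l : List (Fin n)} (hl : ¬ AvoidsWords B l) :
    RingQuot.mkAlgHom k (genRel s) (wordMonomial k l) = 0 := by
  simp only [AvoidsWords, not_forall, not_not] at hl
  obtain ⟨b, hb, u, v, rfl⟩ := hl
  have h0 : RingQuot.mkAlgHom k (genRel s) (wordMonomial k b) = 0 := by
    rw [← map_zero (RingQuot.mkAlgHom k (genRel s))]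
    exact RingQuot.mkAlgHom_rel k ⟨hs ▸ ⟨b, hb, rfl⟩, rfl⟩
  rw [wordMonomial_append, wordMonomial_append, map_mul, map_mul, h0, mul_zero, zero_mul]

lemma linearIndependent_mkAlgHom_wordMonomial (hB : [] ∉ B)
    (hs : s = wordMonomial k '' {b | b ∈ B}) :
    LinearIndependent k fun l : {l : List (Fin n) // AvoidsWords B l} =>
      RingQuot.mkAlgHom k (genRel s) (wordMonomial k l.1) := by
  have hrel : ∀ ⦃a b⦄, genRel s a b → concatAction k B a = concatAction k B b := by
    rintro a _ ⟨ha, rfl⟩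
    rw [hs] at ha
    obtain ⟨b, hb, rfl⟩ := ha
    rw [concatAction_wordMonomial_of_mem hB hb, map_zero]
  refine LinearIndependent.of_comp
    ((LinearMap.applyₗ (Finsupp.single [] (1 : k) : List (Fin n) →₀ k)).comp
      (RingQuot.liftAlgHom k ⟨concatAction k B, hrel⟩).toLinearMap) ?_
  convert (Finsupp.linearIndependent_single_one k (List (Fin n))).comp
    (Subtype.val : {l : List (Fin n) // AvoidsWords B l} → _) Subtype.val_injective using 1
  funext l
  simp [concatAction_wordMonomial_of_avoids l.2]

lemma degF_eq_span (m : ℕ) :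
    degF k n m =
      Submodule.span k (Set.range fun w : Fin m → Fin n => wordMonomial k (List.ofFn w)) := by
  rw [degF, Submodule.span_pow]
  congr 1
  ext a
  rw [Set.mem_pow]
  constructor
  · rintro ⟨f, rfl⟩
    choose g hg using fun i => (f i).2
    refine ⟨g, ?_⟩
    simp only [wordMonomial, List.map_ofFn]
    congr 2
    funext i
    exact hg i
  · rintro ⟨w, rfl⟩
    refine ⟨fun i => ⟨_, w i, rfl⟩, ?_⟩
    simp only [wordMonomial, List.map_ofFn]
    rfl

/-- The degree-`m` component of a monomial algebra has as dimension the number of words of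
length `m` that avoid the defining monomials. -/
theorem finrank_degQ_monomial (hB : [] ∉ B) (hs : s = wordMonomial k '' {b | b ∈ B}) (m : ℕ) :
    Module.finrank k (degQ k s m) =
      Fintype.card {w : Fin m → Fin n // AvoidsWords B (List.ofFn w)} := by
  have hli : LinearIndependent k fun w : {w : Fin m → Fin n // AvoidsWords B (List.ofFn w)} =>
      RingQuot.mkAlgHom k (genRel s) (wordMonomial k (List.ofFn w.1)) :=
    (linearIndependent_mkAlgHom_wordMonomial hB hs).comp
      (fun w : {w : Fin m → Fin n // AvoidsWords B (List.ofFn w)} => ⟨List.ofFn w.1, w.2⟩)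
      fun _ _ h => Subtype.ext (List.ofFn_injective (congrArg Subtype.val h))
  have hspan : degQ k s m = Submodule.span k
      (Set.range fun w : {w : Fin m → Fin n // AvoidsWords B (List.ofFn w)} =>
        RingQuot.mkAlgHom k (genRel s) (wordMonomial k (List.ofFn w.1))) := by
    rw [degQ, degF_eq_span, Submodule.map_span]
    refine le_antisymm (Submodule.span_le.2 ?_) (Submodule.span_mono ?_)
    · rintro _ ⟨_, ⟨w, rfl⟩, rfl⟩
      by_cases hw : AvoidsWords B (List.ofFn w)
      · exact Submodule.subset_span ⟨⟨w, hw⟩, rfl⟩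
      · simp [mkAlgHom_wordMonomial_eq_zero hs hw]
    · rintro _ ⟨w, rfl⟩
      exact ⟨_, ⟨w.1, rfl⟩, rfl⟩
  rw [hspan, finrank_span_eq_card hli]

end MonomialAlgebra

/-- for
`D'' = k⟨x1,x2,x3,x4⟩/(x3², x3x2, x3x1, x4², x4x2, x4x1, x2x1x2, x2x1²)`
one has `dim_k D''_4 = 34` (so no pushout algebra whose cubic relations have
leading terms `x2x1x2` and `x2x1²` can be regular of type (14641)). -/
theorem stmt6 (k : Type) [Field k] [IsAlgClosed k] [CharZero k] :
    ∀ (x1 x2 x3 x4 : FreeAlgebra k (Fin 4)),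
      x1 = FreeAlgebra.ι k 0 → x2 = FreeAlgebra.ι k 1 →
      x3 = FreeAlgebra.ι k 2 → x4 = FreeAlgebra.ι k 3 →
      ∀ s : Set (FreeAlgebra k (Fin 4)),
        s = {x3 ^ 2, x3 * x2, x3 * x1, x4 ^ 2, x4 * x2, x4 * x1,
             x2 * x1 * x2, x2 * x1 ^ 2} →
        Module.finrank k (degQ k s 4) = 34 := by
  rintro _ _ _ _ rfl rfl rfl rfl s hs
  rw [finrank_degQ_monomial
    (B := [[2, 2], [2, 1], [2, 0], [3, 3], [3, 1], [3, 0], [1, 0, 1], [1, 0, 0]]) (by simp)]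
  · decide +kernel
  · rw [hs]
    ext a
    simp [wordMonomial, pow_two, mul_assoc, eq_comm]
end
end

section
/- Let D be a pushout algebra as in the context (whose six quadratic defining relations involve no x3x4 or x4x3 terms, and among which only the first A-relation contains x3^2 and only the first B-relation contains x4^2). Then the images in D of the alternating monomials x3^a (x4x3)^n x4^b, over all a, b ∈ {0,1} and integers n ≥ 0 with (a,n,b) ≠ (0,0,0), are linearly independent over k; in particular each such monomial is nonzero in D. -/
noncomputable section

open FreeAlgebra

/-- The alternating monomial `x3^a (x4x3)^n x4^b`, where `x3 = ι 2`,
`x4 = ι 3`. -/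
def altm (k : Type) [Field k] (t : Fin 2 × ℕ × Fin 2) : FreeAlgebra k (Fin 4) :=
  (FreeAlgebra.ι k 2) ^ (t.1 : ℕ) *
    (FreeAlgebra.ι k 3 * FreeAlgebra.ι k 2) ^ t.2.1 *
    (FreeAlgebra.ι k 3) ^ (t.2.2 : ℕ)

open Polynomial in
/-- The images of `x1, x2, x3, x4` in the `2 × 2` matrices over `k[X]`: the first two vanish,
and the last two square to zero. -/
def altMat (k : Type) [Field k] : Fin 4 → Matrix (Fin 2) (Fin 2) k[X] :=
  ![0, 0, Matrix.single 0 1 1, Matrix.single 1 0 X]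

open Polynomial in
/-- The representation of the free algebra on `k[X]²` with generators acting by `altMat`. -/
def altRep (k : Type) [Field k] :
    FreeAlgebra k (Fin 4) →ₐ[k] Matrix (Fin 2) (Fin 2) k[X] :=
  FreeAlgebra.lift k (altMat k)

lemma altRep_ι (k : Type) [Field k] (i : Fin 4) : altRep k (FreeAlgebra.ι k i) = altMat k i :=
  FreeAlgebra.lift_ι_apply _ _

lemma altMat_two_sq (k : Type) [Field k] : altMat k 2 * altMat k 2 = 0 := by
  simp [altMat]

lemma altMat_three_sq (k : Type) [Field k] : altMat k 3 * altMat k 3 = 0 := by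
  simp [altMat]

lemma altRep_quad_eq_zero (k : Type) [Field k] (c : Fin 4 → Fin 4 → k)
    (h23 : c 2 3 = 0) (h32 : c 3 2 = 0) : altRep k (quad k c) = 0 := by
  have h0 : altMat k 0 = 0 := rfl
  have h1 : altMat k 1 = 0 := rfl
  simp [quad, altRep_ι, Fin.sum_univ_four, h0, h1, h23, h32, altMat_two_sq, altMat_three_sq]

open Polynomial in
lemma altRep_altm (k : Type) [Field k] (t : Fin 2 × ℕ × Fin 2) (ht : t ≠ (0, 0, 0)) :
    altRep k (altm k t) = Matrix.single t.1.rev t.2.2.rev (X ^ (t.2.1 + t.2.2 : ℕ)) := by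
  obtain ⟨a, n, b⟩ := t
  have h43 : altMat k 3 * altMat k 2 = Matrix.single 1 1 X := by simp [altMat]
  have hpow : ∀ m : ℕ,
      (Matrix.single 1 1 X : Matrix (Fin 2) (Fin 2) k[X]) ^ (m + 1) =
        Matrix.single 1 1 (X ^ (m + 1)) := by
    intro m
    induction m with
    | zero => simp
    | succ m ih => rw [pow_succ, ih, Matrix.single_mul_single_same, ← pow_succ]
  have h2 : altMat k 2 = Matrix.single 0 1 1 := rfl
  have h3 : altMat k 3 = Matrix.single 1 0 X := rfl
  simp only [altm, map_mul, map_pow, altRep_ι, h43]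
  rcases n with _ | n
  · fin_cases a <;> fin_cases b <;> simp [h2, h3] at ht ⊢
  · rw [hpow]
    fin_cases a <;> fin_cases b <;> simp [h2, h3, pow_succ]

open Polynomial in
lemma linearIndependent_altRep_altm (k : Type) [Field k] :
    LinearIndependent k
      (fun t : {t : Fin 2 × ℕ × Fin 2 // t ≠ (0, 0, 0)} => altRep k (altm k t.1)) := by
  let B := (Polynomial.basisMonomials k).smulTower (Matrix.stdBasis k[X] (Fin 2) (Fin 2))
  let e : {t : Fin 2 × ℕ × Fin 2 // t ≠ (0, 0, 0)} → ℕ × (Fin 2 × Fin 2) :=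
    fun t => (t.1.2.1 + t.1.2.2, (t.1.1.rev, t.1.2.2.rev))
  have he : Function.Injective e := by
    rintro ⟨⟨a, n, b⟩, _⟩ ⟨⟨a', n', b'⟩, _⟩ h
    simp only [e, Prod.mk.injEq, Fin.rev_inj] at h
    obtain ⟨hn, rfl, rfl⟩ := h
    simpa using hn
  convert B.linearIndependent.comp e he using 1
  funext t
  simp [B, e, altRep_altm k t.1 t.2, Module.Basis.smulTower_apply, Matrix.stdBasis_eq_single,
    Matrix.smul_single, X_pow_eq_monomial]

/-- let `D` be a pushout algebra, whose six quadratic defining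
relations involve no `x3x4` or `x4x3` terms, with only the first A-relation
containing `x3²` and only the first B-relation containing `x4²`.  Then the
images in `D` of the alternating monomials `x3^a (x4x3)^n x4^b`
(`(a,n,b) ≠ (0,0,0)`) are linearly independent over `k`; in particular each
such monomial is nonzero in `D`. -/
theorem stmt7 (k : Type) [Field k] [IsAlgClosed k] [CharZero k]
    (c1 c2 c3 c4 c5 c6 : Fin 4 → Fin 4 → k)
    (h1 : ∀ i j, c1 i j ≠ 0 → i ≠ 3 ∧ j ≠ 3 ∧ ¬(i = 2 ∧ j = 2))
    (h2 : ∀ i j, c2 i j ≠ 0 → i ≠ 3 ∧ j ≠ 3 ∧ ¬(i = 2 ∧ j = 2))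
    (h3 : ∀ i j, c3 i j ≠ 0 → i ≠ 3 ∧ j ≠ 3 ∧ ¬(i = 2 ∧ j = 2))
    (h4 : ∀ i j, c4 i j ≠ 0 → i ≠ 2 ∧ j ≠ 2 ∧ ¬(i = 3 ∧ j = 3))
    (h5 : ∀ i j, c5 i j ≠ 0 → i ≠ 2 ∧ j ≠ 2 ∧ ¬(i = 3 ∧ j = 3))
    (h6 : ∀ i j, c6 i j ≠ 0 → i ≠ 2 ∧ j ≠ 2 ∧ ¬(i = 3 ∧ j = 3)) :
    ∀ s : Set (FreeAlgebra k (Fin 4)),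
      s = {(FreeAlgebra.ι k 2) ^ 2 + quad k c1, quad k c2, quad k c3,
           (FreeAlgebra.ι k 3) ^ 2 + quad k c4, quad k c5, quad k c6} →
      LinearIndependent k
        (fun t : {t : Fin 2 × ℕ × Fin 2 // t ≠ (0, 0, 0)} =>
          RingQuot.mkAlgHom k (genRel s) (altm k t.1)) ∧
      ∀ t : Fin 2 × ℕ × Fin 2, t ≠ (0, 0, 0) →
        RingQuot.mkAlgHom k (genRel s) (altm k t) ≠ 0 := by
  intro s hs
  have hquad : ∀ c : Fin 4 → Fin 4 → k,
      (∀ i j, c i j ≠ 0 → (i ≠ 3 ∧ j ≠ 3) ∨ (i ≠ 2 ∧ j ≠ 2)) → altRep k (quad k c) = 0 := by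
    intro c hc
    refine altRep_quad_eq_zero k c ?_ ?_ <;> by_contra h <;> simpa using hc _ _ h
  have hA : ∀ c : Fin 4 → Fin 4 → k,
      (∀ i j, c i j ≠ 0 → i ≠ 3 ∧ j ≠ 3 ∧ ¬(i = 2 ∧ j = 2)) → altRep k (quad k c) = 0 :=
    fun c hc => hquad c fun i j h => .inl ⟨(hc i j h).1, (hc i j h).2.1⟩
  have hB : ∀ c : Fin 4 → Fin 4 → k,
      (∀ i j, c i j ≠ 0 → i ≠ 2 ∧ j ≠ 2 ∧ ¬(i = 3 ∧ j = 3)) → altRep k (quad k c) = 0 :=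
    fun c hc => hquad c fun i j h => .inr ⟨(hc i j h).1, (hc i j h).2.1⟩
  have hrel : ∀ ⦃x y⦄, genRel s x y → altRep k x = altRep k y := by
    rintro x y ⟨hx, rfl⟩
    rw [hs] at hx
    rw [map_zero]
    rcases hx with rfl | rfl | rfl | rfl | rfl | rfl <;>
      simp [altRep_ι, pow_two, altMat_two_sq, altMat_three_sq, hA _ h1, hA _ h2, hA _ h3,
        hB _ h4, hB _ h5, hB _ h6]
  have hind : LinearIndependent k
      (fun t : {t : Fin 2 × ℕ × Fin 2 // t ≠ (0, 0, 0)} =>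
        RingQuot.mkAlgHom k (genRel s) (altm k t.1)) := by
    refine LinearIndependent.of_comp (RingQuot.liftAlgHom k ⟨altRep k, hrel⟩).toLinearMap ?_
    have hcomp : (RingQuot.liftAlgHom k ⟨altRep k, hrel⟩).toLinearMap ∘
        (fun t : {t : Fin 2 × ℕ × Fin 2 // t ≠ (0, 0, 0)} =>
          RingQuot.mkAlgHom k (genRel s) (altm k t.1)) = fun t => altRep k (altm k t.1) :=
      funext fun t => RingQuot.liftAlgHom_mkAlgHom_apply k (altRep k) hrel _
    rw [hcomp]
    exact linearIndependent_altRep_altm k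
  exact ⟨hind, fun t ht => hind.ne_zero ⟨t, ht⟩⟩
end
end

section
/- In the algebra A = k⟨x3,x1,x2⟩/(f1, f2, f3) of Example 1.1, the cubic identities x2^2·x1 = x1·x2^2 and x2·x1^2 = x1^2·x2 hold; that is, the elements x2^2x1 − x1x2^2 and x2x1^2 − x1^2x2 lie in the two-sided ideal generated by f1, f2, f3 (so the cubic algebra C = k⟨x1,x2⟩/(x2^2x1 − x1x2^2, x2x1^2 − x1^2x2) maps to A). -/
noncomputable section

open FreeAlgebra

/-- If `z` anticommutes with `a` and `z² = ab + ba`, then `a²` commutes with `b`. -/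
theorem mul_sq_eq_sq_mul_of_anticomm {R : Type*} [Ring R] {a b z : R}
    (hz : z ^ 2 = a * b + b * a) (ha : z * a + a * z = 0) : b * a ^ 2 = a ^ 2 * b := by
  have hza : z * a = -(a * z) := eq_neg_of_add_eq_zero_left ha
  have hcomm : z ^ 2 * a = a * z ^ 2 := by
    rw [sq, mul_assoc, hza, mul_neg, ← mul_assoc, hza, neg_mul, neg_neg, mul_assoc]
  rw [hz, add_mul, mul_add, mul_assoc a b a, add_comm, add_left_inj] at hcomm
  simpa only [sq, mul_assoc] using hcomm

/-- In the algebra `A = k⟨x3,x1,x2⟩/(f1,f2,f3)` of Example 1.1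
(with `f1 = x3² − x1x2 − x2x1`, `f2 = x3x1 + x1x3`, `f3 = x3x2 + x2x3`),
the elements `x2²x1 − x1x2²` and `x2x1² − x1²x2` lie in the two-sided ideal
generated by `f1, f2, f3`; i.e. their images in `A` vanish. -/
theorem stmt9 (k : Type) [Field k] [IsAlgClosed k] [CharZero k] :
    ∀ (x1 x2 x3 : FreeAlgebra k (Fin 3)),
      x1 = FreeAlgebra.ι k 0 → x2 = FreeAlgebra.ι k 1 → x3 = FreeAlgebra.ι k 2 →
      ∀ (f1 f2 f3 : FreeAlgebra k (Fin 3)),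
        f1 = x3 ^ 2 - x1 * x2 - x2 * x1 →
        f2 = x3 * x1 + x1 * x3 →
        f3 = x3 * x2 + x2 * x3 →
        RingQuot.mkAlgHom k (genRel {f1, f2, f3}) (x2 ^ 2 * x1 - x1 * x2 ^ 2) = 0 ∧
        RingQuot.mkAlgHom k (genRel {f1, f2, f3}) (x2 * x1 ^ 2 - x1 ^ 2 * x2) = 0 := by
  intro x1 x2 x3 _ _ _ f1 f2 f3 h1 h2 h3
  have hvanish : ∀ f ∈ ({f1, f2, f3} : Set (FreeAlgebra k (Fin 3))),
      RingQuot.mkAlgHom k (genRel {f1, f2, f3}) f = 0 := fun f hf => by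
    rw [RingQuot.mkAlgHom_rel k (show genRel {f1, f2, f3} f 0 from ⟨hf, rfl⟩), map_zero]
  have e1 := hvanish f1 (by simp)
  have e2 := hvanish f2 (by simp)
  have e3 := hvanish f3 (by simp)
  generalize RingQuot.mkAlgHom k (genRel {f1, f2, f3}) = π at e1 e2 e3 ⊢
  subst h1 h2 h3
  simp only [map_sub, map_add, map_mul, map_pow] at e1 e2 e3 ⊢
  replace e1 := sub_eq_zero.1 ((sub_sub _ _ _).symm.trans e1)
  exact ⟨sub_eq_zero.2 (mul_sq_eq_sq_mul_of_anticomm (e1.trans (add_comm _ _)) e3).symm,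
    sub_eq_zero.2 (mul_sq_eq_sq_mul_of_anticomm e1 e2)⟩
end
end

section
/- The pushout algebra D = k⟨x3,x1,x2,x4⟩/(f1,…,f6) of Example 1.1 is both left noetherian and right noetherian. -/
noncomputable section

open FreeAlgebra

/-- Two elements whose squares and anticommutator are scalars: their left multiplications preserve
the span of `1, x, y, x * y`. -/
theorem span_pair_mul_le {R A : Type*} [CommRing R] [Ring A] [Algebra R A] {x y : A} {a b t : R}
    (hx : x * x = algebraMap R A a) (hy : y * y = algebraMap R A b)
    (hxy : x * y + y * x = algebraMap R A t) :
    Submodule.span R {x, y} * Submodule.span R {1, x, y, x * y} ≤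
      Submodule.span R {1, x, y, x * y} := by
  have h1 : (1 : A) ∈ Submodule.span R {1, x, y, x * y} := Submodule.subset_span (by simp)
  have hx' : x ∈ Submodule.span R {1, x, y, x * y} := Submodule.subset_span (by simp)
  have hy' : y ∈ Submodule.span R {1, x, y, x * y} := Submodule.subset_span (by simp)
  have hxy' : x * y ∈ Submodule.span R {1, x, y, x * y} := Submodule.subset_span (by simp)
  have hyx : y * x = t • (1 : A) - x * y := by
    rw [← Algebra.algebraMap_eq_smul_one, ← hxy]; abel
  rw [Submodule.span_mul_span, Submodule.span_le]
  rintro _ ⟨u, hu, v, hv, rfl⟩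
  simp only [Set.mem_insert_iff, Set.mem_singleton_iff] at hu hv
  rcases hu with rfl | rfl <;> rcases hv with rfl | rfl | rfl | rfl <;>
    simp only [SetLike.mem_coe, mul_one]
  · exact hx'
  · rw [hx, Algebra.algebraMap_eq_smul_one]
    exact Submodule.smul_mem _ _ h1
  · exact hxy'
  · rw [← mul_assoc, hx, ← Algebra.smul_def]
    exact Submodule.smul_mem _ _ hy'
  · exact hy'
  · rw [hyx]
    exact Submodule.sub_mem _ (Submodule.smul_mem _ _ h1) hxy'
  · rw [hy, Algebra.algebraMap_eq_smul_one]
    exact Submodule.smul_mem _ _ h1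
  · rw [← mul_assoc, hyx, sub_mul, mul_assoc, hy, ← Algebra.commutes, ← Algebra.smul_def,
      smul_mul_assoc, one_mul]
    exact Submodule.sub_mem _ (Submodule.smul_mem _ _ hy') (Submodule.smul_mem _ _ hx')

/-- An algebra generated by two pairs `x, y` and `z, w`, each with scalar squares and scalar
anticommutator, is module-finite if the elements of the first pair anticommute with those of the
second. -/
theorem module_finite_of_anticommuting_pairs {R A : Type*} [CommRing R] [Ring A] [Algebra R A]
    {x y z w : A} {a b t c d u : R}
    (hx : x * x = algebraMap R A a) (hy : y * y = algebraMap R A b)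
    (hxy : x * y + y * x = algebraMap R A t)
    (hz : z * z = algebraMap R A c) (hw : w * w = algebraMap R A d)
    (hzw : z * w + w * z = algebraMap R A u)
    (hzx : z * x = -(x * z)) (hzy : z * y = -(y * z))
    (hwx : w * x = -(x * w)) (hwy : w * y = -(y * w))
    (hgen : Algebra.adjoin R {x, y, z, w} = ⊤) : Module.Finite R A := by
  set N := Submodule.span R {1, x, y, x * y} with hN
  set P := Submodule.span R {1, z, w, z * w} with hP
  have hxyN : Submodule.span R {x, y} * N ≤ N := span_pair_mul_le hx hy hxy
  have hzwP : Submodule.span R {z, w} * P ≤ P := span_pair_mul_le hz hw hzw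
  have hswap : ∀ v : A, v * x = -(x * v) → v * y = -(y * v) → v ∈ Submodule.span R {z, w} →
      ∀ n ∈ N, v * n ∈ N * Submodule.span R {z, w} := by
    intro v hvx hvy hv n hn
    induction hn using Submodule.span_induction with
    | mem s hs =>
      have key : v * s = s * v ∨ v * s = -(s * v) := by
        simp only [Set.mem_insert_iff, Set.mem_singleton_iff] at hs
        rcases hs with rfl | rfl | rfl | rfl
        · simp
        · exact Or.inr hvx
        · exact Or.inr hvy
        · left
          rw [← mul_assoc, hvx, neg_mul, mul_assoc, hvy, mul_neg, neg_neg, mul_assoc]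
      have hm := Submodule.mul_mem_mul (Submodule.subset_span (R := R) hs) hv
      rcases key with h | h <;> rw [h]
      · exact hm
      · exact Submodule.neg_mem _ hm
    | zero => simp
    | add p q _ _ hp hq => rw [mul_add]; exact Submodule.add_mem _ hp hq
    | smul r p _ hp => rw [mul_smul_comm]; exact Submodule.smul_mem _ _ hp
  have hstable : ∀ v ∈ ({x, y, z, w} : Set A), ∀ m ∈ N * P, v * m ∈ N * P := by
    intro v hv m hm
    have hfirst : v ∈ Submodule.span R {x, y} → v * m ∈ N * P := fun h => by
      have := Submodule.mul_mem_mul h hm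
      rw [← mul_assoc] at this
      exact (mul_le_mul' hxyN le_rfl : _ ≤ N * P) this
    have hsecond : v * x = -(x * v) → v * y = -(y * v) → v ∈ Submodule.span R {z, w} →
        v * m ∈ N * P := fun h h' h'' => by
      refine Submodule.mul_induction_on hm (fun n hn p hp => ?_) (fun p q hp hq => ?_)
      · have := Submodule.mul_mem_mul (hswap v h h' h'' n hn) hp
        rw [mul_assoc N] at this
        rw [← mul_assoc]
        exact (mul_le_mul' le_rfl hzwP : _ ≤ N * P) this
      · rw [mul_add]; exact Submodule.add_mem _ hp hq
    simp only [Set.mem_insert_iff, Set.mem_singleton_iff] at hv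
    rcases hv with rfl | rfl | rfl | rfl
    · exact hfirst (Submodule.subset_span (by simp))
    · exact hfirst (Submodule.subset_span (by simp))
    · exact hsecond hzx hzy (Submodule.subset_span (by simp))
    · exact hsecond hwx hwy (Submodule.subset_span (by simp))
  have hall : ∀ v : A, ∀ m ∈ N * P, v * m ∈ N * P := by
    intro v
    have hv : v ∈ Algebra.adjoin R {x, y, z, w} := hgen ▸ Algebra.mem_top
    induction hv using Algebra.adjoin_induction with
    | mem s hs => exact hstable s hs
    | algebraMap r =>
      intro m hm
      rw [← Algebra.smul_def]; exact Submodule.smul_mem _ _ hm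
    | add p q _ _ hp hq =>
      intro m hm
      rw [add_mul]; exact Submodule.add_mem _ (hp m hm) (hq m hm)
    | mul p q _ _ hp hq =>
      intro m hm
      rw [mul_assoc]; exact hp _ (hq m hm)
  have hone : (1 : A) ∈ N * P := by
    rw [← mul_one (1 : A)]
    exact Submodule.mul_mem_mul (Submodule.subset_span (by simp)) (Submodule.subset_span (by simp))
  have htop : N * P = ⊤ := eq_top_iff.2 fun v _ => mul_one v ▸ hall v 1 hone
  refine Module.finite_def.2 (htop ▸ Submodule.FG.mul ?_ ?_)
  · exact Submodule.fg_span (by simp)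
  · exact Submodule.fg_span (by simp)

/-- An algebra over a noetherian ring generated by elements
satisfying the relations of the pushout algebra is noetherian on both sides. -/
theorem isNoetherianRing_and_op_of_relations {k A : Type*} [CommRing k] [IsNoetherianRing k]
    [Ring A] [Algebra k A] {x y z w : A}
    (hz : z * z = x * y + y * x) (hw : w * w = x * y + y * x)
    (hzx : z * x = -(x * z)) (hzy : z * y = -(y * z))
    (hwx : w * x = -(x * w)) (hwy : w * y = -(y * w))
    (hgen : Algebra.adjoin k {x, y, z, w} = ⊤) :
    IsNoetherianRing A ∧ IsNoetherianRing Aᵐᵒᵖ := by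
  have hcenter : ∀ c : A, Commute c x → Commute c y → Commute c z → Commute c w →
      c ∈ Subalgebra.center k A := by
    intro c hcx hcy hcz hcw
    rw [Subalgebra.mem_center_iff]
    intro v
    have hv : v ∈ Algebra.adjoin k {x, y, z, w} := hgen ▸ Algebra.mem_top
    have hle : Algebra.adjoin k {x, y, z, w} ≤ Subalgebra.centralizer k {c} := by
      refine Algebra.adjoin_le ?_
      simp only [Set.insert_subset_iff, Set.singleton_subset_iff, SetLike.mem_coe,
        Subalgebra.mem_centralizer_iff, Set.mem_singleton_iff, forall_eq]
      exact ⟨hcx.eq, hcy.eq, hcz.eq, hcw.eq⟩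
    exact ((Subalgebra.mem_centralizer_iff k).1 (hle hv) c rfl).symm
  have sq_comm : ∀ p q : A, q * p = -(p * q) → Commute (p * p) q := by
    intro p q h
    rw [commute_iff_eq, ← mul_assoc q, h, neg_mul, mul_assoc p q, h, mul_neg, neg_neg, mul_assoc]
  have anti : ∀ p q : A, q * p = -(p * q) → p * q = -(q * p) := by
    intro p q h
    rw [h, neg_neg]
  have htx : Commute (x * y + y * x) x := hz ▸ sq_comm z x (anti _ _ hzx)
  have hty : Commute (x * y + y * x) y := hz ▸ sq_comm z y (anti _ _ hzy)
  have htz : Commute (x * y + y * x) z := hz ▸ (Commute.refl z).mul_left (Commute.refl z)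
  have htw : Commute (x * y + y * x) w := hw ▸ (Commute.refl w).mul_left (Commute.refl w)
  have sq_comm_of_anticomm : ∀ p q : A, Commute (p * q + q * p) p → Commute (p * p) q := by
    intro p q h
    have h' := h.eq
    rw [add_mul, mul_add, mul_assoc p q p, add_comm] at h'
    rw [commute_iff_eq, mul_assoc, ← add_right_cancel h', mul_assoc]
  have ht := hcenter _ htx hty htz htw
  have ha := hcenter (x * x) ((Commute.refl x).mul_left (Commute.refl x))
    (sq_comm_of_anticomm x y htx) (sq_comm x z hzx) (sq_comm x w hwx)
  have hb := hcenter (y * y) (sq_comm_of_anticomm y x (add_comm (x * y) _ ▸ hty))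
    ((Commute.refl y).mul_left (Commute.refl y)) (sq_comm y z hzy) (sq_comm y w hwy)
  have prod_comm : ∀ p q v : A, p * v = -(v * p) → q * v = -(v * q) → Commute (p * q) v := by
    intro p q v hp hq
    rw [commute_iff_eq, mul_assoc, hq, mul_neg, ← mul_assoc, hp, neg_mul, neg_neg, mul_assoc]
  have anticomm_comm : ∀ p q : A, Commute (p * p) q → Commute (p * q + q * p) p := by
    intro p q h
    rw [commute_iff_eq, add_mul, mul_add, mul_assoc q p p, ← h.eq, mul_assoc p q p,
      mul_assoc p p q, add_comm]
  have hu := hcenter (z * w + w * z)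
    ((prod_comm z w x hzx hwx).add_left (prod_comm w z x hwx hzx))
    ((prod_comm z w y hzy hwy).add_left (prod_comm w z y hwy hzy))
    (anticomm_comm z w (hz ▸ htw)) (add_comm (w * z) _ ▸ anticomm_comm w z (hw ▸ htz))
  let φ : MvPolynomial (Fin 4) k →ₐ[k] Subalgebra.center k A :=
    MvPolynomial.aeval ![⟨_, ha⟩, ⟨_, hb⟩, ⟨_, ht⟩, ⟨_, hu⟩]
  let ψ : MvPolynomial (Fin 4) k →ₐ[k] A := (Subalgebra.center k A).val.comp φ
  let _ : Algebra (MvPolynomial (Fin 4) k) A := ψ.toRingHom.toAlgebra' fun p v =>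
    ((Subalgebra.mem_center_iff.1 (φ p).2) v).symm
  have hmap : ∀ p, algebraMap (MvPolynomial (Fin 4) k) A p = φ p := fun _ => rfl
  have : IsScalarTower k (MvPolynomial (Fin 4) k) A :=
    IsScalarTower.of_algebraMap_eq fun r => (ψ.commutes r).symm
  have hgen' : Algebra.adjoin (MvPolynomial (Fin 4) k) {x, y, z, w} = ⊤ := by
    refine eq_top_iff.2 fun v _ => ?_
    have hle : Algebra.adjoin k {x, y, z, w} ≤
        (Algebra.adjoin (MvPolynomial (Fin 4) k) {x, y, z, w}).restrictScalars k :=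
      Algebra.adjoin_le Algebra.subset_adjoin
    exact hle (hgen ▸ Algebra.mem_top)
  have : Module.Finite (MvPolynomial (Fin 4) k) A := by
    refine module_finite_of_anticommuting_pairs (a := MvPolynomial.X 0) (b := MvPolynomial.X 1)
      (t := MvPolynomial.X 2) (c := MvPolynomial.X 2) (d := MvPolynomial.X 2)
      (u := MvPolynomial.X 3) ?_ ?_ ?_ ?_ ?_ ?_ hzx hzy hwx hwy hgen' <;>
    simp [hmap, φ, hz, hw]
  have : Module.Finite (MvPolynomial (Fin 4) k) Aᵐᵒᵖ :=
    Module.Finite.equiv (MulOpposite.opLinearEquiv (MvPolynomial (Fin 4) k))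
  exact ⟨IsNoetherianRing.of_finite (MvPolynomial (Fin 4) k) A,
    IsNoetherianRing.of_finite (MvPolynomial (Fin 4) k) Aᵐᵒᵖ⟩

/-- The pushout algebra `D = k⟨x3,x1,x2,x4⟩/(f1,…,f6)` of
Example 1.1 is both left noetherian and right noetherian. -/
theorem stmt11 (k : Type) [Field k] [IsAlgClosed k] [CharZero k] :
    ∀ (x1 x2 x3 x4 : FreeAlgebra k (Fin 4)),
      x1 = FreeAlgebra.ι k 0 → x2 = FreeAlgebra.ι k 1 →
      x3 = FreeAlgebra.ι k 2 → x4 = FreeAlgebra.ι k 3 →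
      ∀ (f1 f2 f3 f4 f5 f6 : FreeAlgebra k (Fin 4)),
        f1 = x3 ^ 2 - x1 * x2 - x2 * x1 →
        f2 = x3 * x1 + x1 * x3 →
        f3 = x3 * x2 + x2 * x3 →
        f4 = x4 ^ 2 - x1 * x2 - x2 * x1 →
        f5 = x4 * x1 + x1 * x4 →
        f6 = x4 * x2 + x2 * x4 →
        IsNoetherianRing (RingQuot (genRel {f1, f2, f3, f4, f5, f6})) ∧
        IsNoetherianRing (RingQuot (genRel {f1, f2, f3, f4, f5, f6}))ᵐᵒᵖ := by
  rintro x1 x2 x3 x4 h1 h2 h3 h4 f1 f2 f3 f4 f5 f6 hf1 hf2 hf3 hf4 hf5 hf6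
  set s : Set (FreeAlgebra k (Fin 4)) := {f1, f2, f3, f4, f5, f6} with hs
  let π := RingQuot.mkAlgHom k (genRel s)
  have hπ : ∀ f ∈ s, π f = 0 := fun f hf => by
    rw [← map_zero π]
    exact RingQuot.mkAlgHom_rel k ⟨hf, rfl⟩
  have e1 := hπ f1 (by simp [hs])
  have e2 := hπ f2 (by simp [hs])
  have e3 := hπ f3 (by simp [hs])
  have e4 := hπ f4 (by simp [hs])
  have e5 := hπ f5 (by simp [hs])
  have e6 := hπ f6 (by simp [hs])
  simp only [hf1, hf2, hf3, hf4, hf5, hf6, map_sub, map_add, map_mul, pow_two,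
    sub_sub] at e1 e2 e3 e4 e5 e6
  refine isNoetherianRing_and_op_of_relations (k := k) (x := π x1) (y := π x2) (z := π x3)
    (w := π x4) (sub_eq_zero.1 e1) (sub_eq_zero.1 e4) (eq_neg_of_add_eq_zero_left e2)
    (eq_neg_of_add_eq_zero_left e3) (eq_neg_of_add_eq_zero_left e5)
    (eq_neg_of_add_eq_zero_left e6) ?_
  have himage : ({π x1, π x2, π x3, π x4} : Set _) = π '' Set.range (FreeAlgebra.ι k) := by
    rw [← Set.range_comp]
    ext v
    simp [Fin.exists_fin_succ, h1, h2, h3, h4, eq_comm]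
  rw [himage, ← AlgHom.map_adjoin, FreeAlgebra.adjoin_range_ι, Algebra.map_top,
    AlgHom.range_eq_top]
  exact RingQuot.mkAlgHom_surjective k _
end
end

section
/- In the algebra D1 of the context, the element g := x2x1 − x1x2 − a1·x1^2 satisfies g = x3^2 = x4^2, and g is a normal element of D1; explicitly, g·x1 = x1·g, g·x3 = x3·g, g·x4 = x4·g, and g·x2 = (x2 − 2(1−a1)x1)·g, so that g·D1 = D1·g. -/
noncomputable section

open FreeAlgebra

/-- If `g` passes through each generator from left to right, it passes through every element
of an algebra that is a quotient of a free algebra. -/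
theorem exists_mul_eq_mul_of_generators {k X A : Type*} [CommSemiring k] [Semiring A]
    [Algebra k A] {π : FreeAlgebra k X →ₐ[k] A} (hπ : Function.Surjective π) {g : A}
    (h : ∀ i, ∃ z, g * π (ι k i) = z * g) (y : A) : ∃ z, g * y = z * g := by
  obtain ⟨y, rfl⟩ := hπ y
  induction y using FreeAlgebra.induction with
  | grade0 r => exact ⟨algebraMap k A r, by rw [AlgHom.commutes, Algebra.commutes]⟩
  | grade1 i => exact h i
  | mul a b ha hb =>
    obtain ⟨u, hu⟩ := ha
    obtain ⟨v, hv⟩ := hb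
    exact ⟨u * v, by rw [map_mul, ← mul_assoc, hu, mul_assoc, hv, mul_assoc]⟩
  | add a b ha hb =>
    obtain ⟨u, hu⟩ := ha
    obtain ⟨v, hv⟩ := hb
    exact ⟨u + v, by rw [map_add, mul_add, hu, hv, add_mul]⟩

/-- If `g` passes through each generator from right to left, it passes through every element
of an algebra that is a quotient of a free algebra. -/
theorem exists_mul_eq_mul_of_generators' {k X A : Type*} [CommSemiring k] [Semiring A]
    [Algebra k A] {π : FreeAlgebra k X →ₐ[k] A} (hπ : Function.Surjective π) {g : A}
    (h : ∀ i, ∃ z, π (ι k i) * g = g * z) (y : A) : ∃ z, y * g = g * z := by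
  obtain ⟨y, rfl⟩ := hπ y
  induction y using FreeAlgebra.induction with
  | grade0 r => exact ⟨algebraMap k A r, by rw [AlgHom.commutes, Algebra.commutes]⟩
  | grade1 i => exact h i
  | mul a b ha hb =>
    obtain ⟨u, hu⟩ := ha
    obtain ⟨v, hv⟩ := hb
    exact ⟨u * v, by rw [map_mul, mul_assoc, hv, ← mul_assoc, hu, mul_assoc]⟩
  | add a b ha hb =>
    obtain ⟨u, hu⟩ := ha
    obtain ⟨v, hv⟩ := hb
    exact ⟨u + v, by rw [map_add, add_mul, hu, hv, mul_add]⟩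

/-- The square of an element that commutes with `a` up to a sign commutes with `a`. -/
theorem sq_mul_of_mul_eq_smul {k A : Type*} [CommSemiring k] [Semiring A] [Algebra k A]
    {p : k} (hp : p ^ 2 = 1) {a c : A} (h : c * a = p • (a * c)) : c ^ 2 * a = a * c ^ 2 := by
  rw [pow_two, mul_assoc, h, mul_smul_comm, ← mul_assoc, h, smul_mul_assoc, smul_smul,
    ← pow_two, hp, one_smul, mul_assoc]

/-- The square of an element skew-commuting with `a`, and with `b` up to a multiple of `a`,
acts on `b` by a shear. -/
theorem sq_mul_of_mul_eq_smul_sub {k A : Type*} [CommRing k] [Ring A] [Algebra k A]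
    {p t : k} (hp : p ^ 2 = 1) {a b c : A} (h : c * a = p • (a * c))
    (h' : c * b = p • (b * c) - (p * t) • (a * c)) :
    c ^ 2 * b = (b - (2 * t) • a) * c ^ 2 := by
  have hpp : p * p = 1 := by rw [← pow_two, hp]
  have hpt : p * t * p = t := by rw [mul_right_comm, hpp, one_mul]
  rw [pow_two, mul_assoc, h', mul_sub, mul_smul_comm, mul_smul_comm, ← mul_assoc, h',
    ← mul_assoc c a, h, sub_mul, smul_mul_assoc, smul_mul_assoc, smul_mul_assoc, smul_sub,
    smul_smul, smul_smul, smul_smul, ← mul_assoc p p t, hpp, hpt, one_mul, one_smul, sub_mul,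
    smul_mul_assoc, two_mul, add_smul, mul_assoc, mul_assoc]
  abel

/-- in the algebra `D1` (with `p² = 1`, `q² = 1`), the element
`g := x2x1 − x1x2 − a1·x1²` satisfies `g = x3² = x4²` and is normal, with the
explicit commutation rules `g·x1 = x1·g`, `g·x3 = x3·g`, `g·x4 = x4·g`,
`g·x2 = (x2 − 2(1−a1)x1)·g`, so that `g·D1 = D1·g`. -/
theorem stmt13 (k : Type) [Field k] [IsAlgClosed k] [CharZero k]
    (p q a1 : k) (hp : p ^ 2 = 1) (hq : q ^ 2 = 1) :
    ∀ (x1 x2 x3 x4 : FreeAlgebra k (Fin 4)),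
      x1 = FreeAlgebra.ι k 0 → x2 = FreeAlgebra.ι k 1 →
      x3 = FreeAlgebra.ι k 2 → x4 = FreeAlgebra.ι k 3 →
      ∀ (r1 r2 r3 r4 r5 r6 : FreeAlgebra k (Fin 4)),
        r1 = x3 ^ 2 - x2 * x1 + x1 * x2 + a1 • x1 ^ 2 →
        r2 = x3 * x1 - p • (x1 * x3) →
        r3 = x3 * x2 - p • (x2 * x3) + (p * (1 - a1)) • (x1 * x3) →
        r4 = x4 ^ 2 - x2 * x1 + x1 * x2 + a1 • x1 ^ 2 →
        r5 = x4 * x1 - q • (x1 * x4) →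
        r6 = x4 * x2 - q • (x2 * x4) + (q * (1 - a1)) • (x1 * x4) →
        ∀ (π : FreeAlgebra k (Fin 4) →ₐ[k]
            RingQuot (genRel {r1, r2, r3, r4, r5, r6})),
          π = RingQuot.mkAlgHom k (genRel {r1, r2, r3, r4, r5, r6}) →
          ∀ g, g = π (x2 * x1 - x1 * x2 - a1 • x1 ^ 2) →
            g = π (x3 ^ 2) ∧
            g = π (x4 ^ 2) ∧
            g * π x1 = π x1 * g ∧
            g * π x3 = π x3 * g ∧
            g * π x4 = π x4 * g ∧
            g * π x2 = π (x2 - (2 * (1 - a1)) • x1) * g ∧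
            Set.range (fun y : RingQuot (genRel {r1, r2, r3, r4, r5, r6}) => g * y) =
              Set.range (fun y : RingQuot (genRel {r1, r2, r3, r4, r5, r6}) => y * g) := by
  intro x1 x2 x3 x4 hx1 hx2 hx3 hx4 r1 r2 r3 r4 r5 r6 h1 h2 h3 h4 h5 h6 π hπ g hg
  have hrel : ∀ r ∈ ({r1, r2, r3, r4, r5, r6} : Set (FreeAlgebra k (Fin 4))), π r = 0 := by
    intro r hr
    rw [hπ, ← map_zero (RingQuot.mkAlgHom k (genRel {r1, r2, r3, r4, r5, r6}))]
    exact RingQuot.mkAlgHom_rel k ⟨hr, rfl⟩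
  have hsurj : Function.Surjective π := hπ ▸ RingQuot.mkAlgHom_surjective k _
  have e1 := (congrArg π h1).symm.trans (hrel r1 (by simp))
  have e2 := (congrArg π h2).symm.trans (hrel r2 (by simp))
  have e3 := (congrArg π h3).symm.trans (hrel r3 (by simp))
  have e4 := (congrArg π h4).symm.trans (hrel r4 (by simp))
  have g3 : g = π (x3 ^ 2) := by
    rw [hg, ← sub_eq_zero, ← map_sub, ← neg_eq_zero, ← map_neg, ← e1]
    congr 1
    abel
  have g4 : g = π (x4 ^ 2) := by
    rw [hg, ← sub_eq_zero, ← map_sub, ← neg_eq_zero, ← map_neg, ← e4]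
    congr 1
    abel
  have c31 : π x3 * π x1 = p • (π x1 * π x3) := by
    simpa [sub_eq_zero] using e2
  have c32 : π x3 * π x2 = p • (π x2 * π x3) - (p * (1 - a1)) • (π x1 * π x3) := by
    rw [map_add, map_sub, map_smul, map_smul, map_mul, map_mul, map_mul] at e3
    rw [← sub_eq_zero, ← e3]
    abel
  have gx1 : g * π x1 = π x1 * g := by
    rw [g3, map_pow]
    exact sq_mul_of_mul_eq_smul hp c31
  have gx2 : g * π x2 = π (x2 - (2 * (1 - a1)) • x1) * g := by
    rw [g3, map_pow, map_sub, map_smul]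
    exact sq_mul_of_mul_eq_smul_sub hp c31 c32
  have gx3 : g * π x3 = π x3 * g := by
    rw [g3, map_pow, ← pow_succ, ← pow_succ']
  have gx4 : g * π x4 = π x4 * g := by
    rw [g4, map_pow, ← pow_succ, ← pow_succ']
  have x2g : π x2 * g = g * (π x2 + (2 * (1 - a1)) • π x1) := by
    rw [mul_add, gx2, mul_smul_comm, gx1, map_sub, map_smul, sub_mul, smul_mul_assoc,
      sub_add_cancel]
  refine ⟨g3, g4, gx1, gx3, gx4, gx2, Set.Subset.antisymm ?_ ?_⟩
  · rintro _ ⟨y, rfl⟩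
    obtain ⟨z, hz⟩ := exists_mul_eq_mul_of_generators hsurj (g := g) (fun i => by
      fin_cases i
      · exact ⟨_, hx1 ▸ gx1⟩
      · exact ⟨_, hx2 ▸ gx2⟩
      · exact ⟨_, hx3 ▸ gx3⟩
      · exact ⟨_, hx4 ▸ gx4⟩) y
    exact ⟨z, hz.symm⟩
  · rintro _ ⟨y, rfl⟩
    obtain ⟨z, hz⟩ := exists_mul_eq_mul_of_generators' hsurj (g := g) (fun i => by
      fin_cases i
      · exact ⟨_, hx1 ▸ gx1.symm⟩
      · exact ⟨_, hx2 ▸ x2g⟩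
      · exact ⟨_, hx3 ▸ gx3.symm⟩
      · exact ⟨_, hx4 ▸ gx4.symm⟩) y
    exact ⟨z, hz.symm⟩
end
end

section
/- The algebra D1 of the context is isomorphic to its opposite algebra: there exists a k-algebra isomorphism D1 → D1^{op} sending x1 to −x1 and fixing x2, x3, x4 (equivalently, D1 admits a k-linear antiautomorphism ψ with ψ(x1) = −x1, ψ(x2) = x2, ψ(x3) = x3, ψ(x4) = x4). -/
noncomputable section

open FreeAlgebra

/-- A homomorphism `f : A → Aᵐᵒᵖ` whose underlying self-map of `A` is an involution
is an isomorphism. -/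
def algEquivOpOfInvolutive {k A : Type*} [CommSemiring k] [Semiring A] [Algebra k A]
    (f : A →ₐ[k] Aᵐᵒᵖ) (h : (AlgHom.opComm f).comp f = AlgHom.id k A) : A ≃ₐ[k] Aᵐᵒᵖ :=
  AlgEquiv.ofAlgHom f (AlgHom.opComm f)
    (AlgHom.ext fun x => MulOpposite.unop_injective (DFunLike.congr_fun h x.unop)) h

/-- Every element of `s` vanishes in the quotient algebra. -/
theorem mkAlgHom_genRel_eq_zero {k : Type} [Field k] {n : ℕ} {s : Set (FreeAlgebra k (Fin n))}
    {r : FreeAlgebra k (Fin n)} (hr : r ∈ s) : RingQuot.mkAlgHom k (genRel s) r = 0 := by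
  simpa using RingQuot.mkAlgHom_rel k (s := genRel s) (x := r) (y := 0) ⟨hr, rfl⟩

/-- The quadratic relation is preserved on reversing products and negating `x`. -/
theorem reversed_quadratic_relation {k A : Type*} [CommRing k] [Ring A] [Algebra k A]
    {a : k} {x y z : A} (h : z ^ 2 - y * x + x * y + a • x ^ 2 = 0) :
    z ^ 2 - -x * y + y * -x + a • (-x) ^ 2 = 0 := by
  rw [← h, neg_sq]
  noncomm_ring

/-- The skew-commutation relation is preserved on reversing products and negating `x`. -/
theorem reversed_skew_relation {k A : Type*} [CommRing k] [Ring A] [Algebra k A]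
    {p : k} (hp : p ^ 2 = 1) {x z : A} (h : z * x - p • (x * z) = 0) :
    -x * z - p • (z * -x) = 0 := by
  rw [mul_neg, sub_eq_zero.1 h, smul_neg, smul_smul, ← sq, hp]
  simp

/-- The perturbed skew-commutation relation is preserved on reversing products and
negating `x`. -/
theorem reversed_perturbed_skew_relation {k A : Type*} [CommRing k] [Ring A] [Algebra k A]
    {p a : k} (hp : p ^ 2 = 1) {x y z : A} (h : z * x - p • (x * z) = 0)
    (h' : z * y - p • (y * z) + (p * (1 - a)) • (x * z) = 0) :
    y * z - p • (z * y) + (p * (1 - a)) • (z * -x) = 0 := by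
  have e : z * x = p • (x * z) := sub_eq_zero.1 h
  have e' : z * y = p • (y * z) - (p * (1 - a)) • (x * z) := by
    rw [← sub_eq_zero, ← h']
    abel
  rw [mul_neg, e, e']
  simp only [smul_sub, smul_neg, smul_smul]
  rw [show p * p = 1 by rw [← sq, hp], show p * (1 - a) * p = p * (p * (1 - a)) by ring]
  simp

/-- the algebra `D1` (with `p² = 1`, `q² = 1`) is isomorphic to
its opposite algebra, via a `k`-algebra isomorphism `D1 ≃ D1ᵒᵖ` sending `x1`
to `−x1` and fixing `x2, x3, x4`. -/
theorem stmt14 (k : Type) [Field k] [IsAlgClosed k] [CharZero k]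
    (p q a1 : k) (hp : p ^ 2 = 1) (hq : q ^ 2 = 1) :
    ∀ (x1 x2 x3 x4 : FreeAlgebra k (Fin 4)),
      x1 = FreeAlgebra.ι k 0 → x2 = FreeAlgebra.ι k 1 →
      x3 = FreeAlgebra.ι k 2 → x4 = FreeAlgebra.ι k 3 →
      ∀ (r1 r2 r3 r4 r5 r6 : FreeAlgebra k (Fin 4)),
        r1 = x3 ^ 2 - x2 * x1 + x1 * x2 + a1 • x1 ^ 2 →
        r2 = x3 * x1 - p • (x1 * x3) →
        r3 = x3 * x2 - p • (x2 * x3) + (p * (1 - a1)) • (x1 * x3) →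
        r4 = x4 ^ 2 - x2 * x1 + x1 * x2 + a1 • x1 ^ 2 →
        r5 = x4 * x1 - q • (x1 * x4) →
        r6 = x4 * x2 - q • (x2 * x4) + (q * (1 - a1)) • (x1 * x4) →
        ∀ (π : FreeAlgebra k (Fin 4) →ₐ[k]
            RingQuot (genRel {r1, r2, r3, r4, r5, r6})),
          π = RingQuot.mkAlgHom k (genRel {r1, r2, r3, r4, r5, r6}) →
          ∃ ψ : RingQuot (genRel {r1, r2, r3, r4, r5, r6}) ≃ₐ[k]
              (RingQuot (genRel {r1, r2, r3, r4, r5, r6}))ᵐᵒᵖ,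
            ψ (π x1) = MulOpposite.op (π (-x1)) ∧
            ψ (π x2) = MulOpposite.op (π x2) ∧
            ψ (π x3) = MulOpposite.op (π x3) ∧
            ψ (π x4) = MulOpposite.op (π x4) := by
  rintro _ _ _ _ rfl rfl rfl rfl r1 r2 r3 r4 r5 r6 h1 h2 h3 h4 h5 h6 π hπ
  have hr : ∀ r ∈ ({r1, r2, r3, r4, r5, r6} : Set (FreeAlgebra k (Fin 4))), π r = 0 := by
    rw [hπ]
    exact fun r => mkAlgHom_genRel_eq_zero
  have e1 := (congrArg π h1).symm.trans (hr r1 (by simp))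
  have e2 := (congrArg π h2).symm.trans (hr r2 (by simp))
  have e3 := (congrArg π h3).symm.trans (hr r3 (by simp))
  have e4 := (congrArg π h4).symm.trans (hr r4 (by simp))
  have e5 := (congrArg π h5).symm.trans (hr r5 (by simp))
  have e6 := (congrArg π h6).symm.trans (hr r6 (by simp))
  simp only [map_add, map_sub, map_mul, map_smul, map_pow] at e1 e2 e3 e4 e5 e6
  let F : FreeAlgebra k (Fin 4) →ₐ[k] (RingQuot (genRel {r1, r2, r3, r4, r5, r6}))ᵐᵒᵖ :=
    FreeAlgebra.lift k fun i => MulOpposite.op (π (if i = 0 then -ι k i else ι k i))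
  have hF0 : F (ι k 0) = MulOpposite.op (-π (ι k 0)) := by simp [F]
  have hF1 : F (ι k 1) = MulOpposite.op (π (ι k 1)) := by simp [F]
  have hF2 : F (ι k 2) = MulOpposite.op (π (ι k 2)) := by simp [F]
  have hF3 : F (ι k 3) = MulOpposite.op (π (ι k 3)) := by simp [F]
  have hF : ∀ ⦃x y⦄, genRel {r1, r2, r3, r4, r5, r6} x y → F x = F y := by
    rintro x _ ⟨hx, rfl⟩
    rw [map_zero]
    apply MulOpposite.unop_injective
    rcases hx with rfl | rfl | rfl | rfl | rfl | rfl
    · simpa [h1, hF0, hF1, hF2] using reversed_quadratic_relation e1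
    · simpa [h2, hF0, hF2] using reversed_skew_relation hp e2
    · simpa [h3, hF0, hF1, hF2] using reversed_perturbed_skew_relation hp e2 e3
    · simpa [h4, hF0, hF1, hF3] using reversed_quadratic_relation e4
    · simpa [h5, hF0, hF3] using reversed_skew_relation hq e5
    · simpa [h6, hF0, hF1, hF3] using reversed_perturbed_skew_relation hq e5 e6
  let G := RingQuot.liftAlgHom k ⟨F, hF⟩
  have hG : ∀ x, G (π x) = F x := by
    intro x
    rw [hπ]
    exact RingQuot.liftAlgHom_mkAlgHom_apply k F hF x
  refine ⟨algEquivOpOfInvolutive G ?_, ?_, ?_, ?_, ?_⟩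
  · apply RingQuot.ringQuot_ext'
    rw [← hπ]
    ext i
    fin_cases i <;> simp [hG, hF0, hF1, hF2, hF3]
  · exact (hG _).trans (by rw [hF0, map_neg])
  · exact (hG _).trans hF1
  · exact (hG _).trans hF2
  · exact (hG _).trans hF3
end
end

section
/- In the algebra D2 of the context, the element g := x4x3 − x3x4 is normal, with explicit commutation rules g·x1 = a^2·x1·g, g·x2 = a^{-2}·x2·g, g·x3 = −x3·g, g·x4 = −x4·g; moreover the element h := x2x1 + c·a^{-2}·x1x2 satisfies h = x3^2 = x4^2 and is normal, with h·x1 = a^2·x1·h, h·x2 = a^{-2}·x2·h, h·x3 = x3·h, h·x4 = x4·h. -/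
noncomputable section

open FreeAlgebra

/-- An element that commutes with each generator of an algebra up to a nonzero scalar
is normal. -/
theorem range_mul_left_eq_range_mul_right {k R X : Type*} [Field k] [Ring R] [Algebra k R]
    (f : FreeAlgebra k X →ₐ[k] R) (hf : Function.Surjective f) (g : R) (q : X → k)
    (hq : ∀ i, q i ≠ 0)
    (hg : ∀ i, g * f (FreeAlgebra.ι k i) = q i • (f (FreeAlgebra.ι k i) * g)) :
    Set.range (fun y : R => g * y) = Set.range (fun y : R => y * g) := by
  have left : ∀ y : FreeAlgebra k X, ∃ z, z * g = g * f y := by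
    intro y
    induction y using FreeAlgebra.induction with
    | grade0 r => exact ⟨algebraMap k R r, by rw [AlgHom.commutes, Algebra.commutes]⟩
    | grade1 i => exact ⟨q i • f (FreeAlgebra.ι k i), by rw [hg, smul_mul_assoc]⟩
    | mul y₁ y₂ h₁ h₂ =>
      obtain ⟨z₁, h₁⟩ := h₁
      obtain ⟨z₂, h₂⟩ := h₂
      exact ⟨z₁ * z₂, by rw [mul_assoc, h₂, ← mul_assoc, h₁, map_mul, mul_assoc]⟩
    | add y₁ y₂ h₁ h₂ =>
      obtain ⟨z₁, h₁⟩ := h₁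
      obtain ⟨z₂, h₂⟩ := h₂
      exact ⟨z₁ + z₂, by rw [add_mul, h₁, h₂, map_add, mul_add]⟩
  have right : ∀ y : FreeAlgebra k X, ∃ z, g * z = f y * g := by
    intro y
    induction y using FreeAlgebra.induction with
    | grade0 r => exact ⟨algebraMap k R r, by rw [AlgHom.commutes, Algebra.commutes]⟩
    | grade1 i =>
      exact ⟨(q i)⁻¹ • f (FreeAlgebra.ι k i), by
        rw [mul_smul_comm, hg, smul_smul, inv_mul_cancel₀ (hq i), one_smul]⟩
    | mul y₁ y₂ h₁ h₂ =>
      obtain ⟨z₁, h₁⟩ := h₁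
      obtain ⟨z₂, h₂⟩ := h₂
      exact ⟨z₁ * z₂, by rw [← mul_assoc, h₁, mul_assoc, h₂, map_mul, mul_assoc]⟩
    | add y₁ y₂ h₁ h₂ =>
      obtain ⟨z₁, h₁⟩ := h₁
      obtain ⟨z₂, h₂⟩ := h₂
      exact ⟨z₁ + z₂, by rw [mul_add, h₁, h₂, map_add, add_mul]⟩
  apply Set.Subset.antisymm
  · rintro _ ⟨y, rfl⟩
    obtain ⟨y, rfl⟩ := hf y
    exact left y
  · rintro _ ⟨y, rfl⟩
    obtain ⟨y, rfl⟩ := hf y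
    exact right y

/-- If `u` and `v` both commute with `x` up to the scalar `q`, then `u * v` commutes with `x`
up to the scalar `q ^ 2`. -/
theorem mul_mul_eq_sq_smul {k R : Type*} [Field k] [Ring R] [Algebra k R] {q : k} {u v x : R}
    (hu : u * x = q • (x * u)) (hv : v * x = q • (x * v)) :
    u * v * x = q ^ 2 • (x * (u * v)) := by
  rw [mul_assoc, hv, mul_smul_comm, ← mul_assoc, hu, smul_mul_assoc, smul_smul, mul_assoc, sq]

/-- The commutator `v * u - u * v` of two elements with the same square anticommutes with `u`. -/
theorem commutator_mul_right_eq_neg {R : Type*} [Ring R] {u v : R} (h : u * u = v * v) :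
    (v * u - u * v) * u = -(u * (v * u - u * v)) := by
  have e : v * (u * u) = u * u * v := by rw [h, mul_assoc]
  calc (v * u - u * v) * u = v * (u * u) - u * v * u := by noncomm_ring
    _ = u * u * v - u * v * u := by rw [e]
    _ = -(u * (v * u - u * v)) := by noncomm_ring

/-- The commutator `v * u - u * v` of two elements with the same square anticommutes with `v`. -/
theorem commutator_mul_left_eq_neg {R : Type*} [Ring R] {u v : R} (h : u * u = v * v) :
    (v * u - u * v) * v = -(v * (v * u - u * v)) := by
  rw [← neg_sub (u * v), neg_mul, commutator_mul_right_eq_neg h.symm, mul_neg]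

/-- in the algebra `D2` (with `a ≠ 0`, `c ≠ 0`), the element
`g := x4x3 − x3x4` is normal with commutation rules `g·x1 = a²·x1·g`,
`g·x2 = a⁻²·x2·g`, `g·x3 = −x3·g`, `g·x4 = −x4·g`; and
`h := x2x1 + c·a⁻²·x1x2` satisfies `h = x3² = x4²` and is normal with
`h·x1 = a²·x1·h`, `h·x2 = a⁻²·x2·h`, `h·x3 = x3·h`, `h·x4 = x4·h`. -/
theorem stmt15 (k : Type) [Field k] [IsAlgClosed k] [CharZero k]
    (a c : k) (ha : a ≠ 0) (hc : c ≠ 0) :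
    ∀ (x1 x2 x3 x4 : FreeAlgebra k (Fin 4)),
      x1 = FreeAlgebra.ι k 0 → x2 = FreeAlgebra.ι k 1 →
      x3 = FreeAlgebra.ι k 2 → x4 = FreeAlgebra.ι k 3 →
      ∀ (r1 r2 r3 r4 r5 r6 : FreeAlgebra k (Fin 4)),
        r1 = x3 ^ 2 - x2 * x1 - (c * (a ^ 2)⁻¹) • (x1 * x2) →
        r2 = x3 * x1 - a • (x1 * x3) →
        r3 = x3 * x2 - a⁻¹ • (x2 * x3) →
        r4 = x4 ^ 2 - x2 * x1 - (c * (a ^ 2)⁻¹) • (x1 * x2) →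
        r5 = x4 * x1 - a • (x1 * x4) →
        r6 = x4 * x2 - a⁻¹ • (x2 * x4) →
        ∀ (π : FreeAlgebra k (Fin 4) →ₐ[k]
            RingQuot (genRel {r1, r2, r3, r4, r5, r6})),
          π = RingQuot.mkAlgHom k (genRel {r1, r2, r3, r4, r5, r6}) →
          ∀ g h, g = π (x4 * x3 - x3 * x4) →
            h = π (x2 * x1 + (c * (a ^ 2)⁻¹) • (x1 * x2)) →
            (Set.range (fun y : RingQuot (genRel {r1, r2, r3, r4, r5, r6}) => g * y) =
              Set.range (fun y : RingQuot (genRel {r1, r2, r3, r4, r5, r6}) => y * g)) ∧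
            g * π x1 = a ^ 2 • (π x1 * g) ∧
            g * π x2 = (a ^ 2)⁻¹ • (π x2 * g) ∧
            g * π x3 = -(π x3 * g) ∧
            g * π x4 = -(π x4 * g) ∧
            h = π (x3 ^ 2) ∧
            h = π (x4 ^ 2) ∧
            (Set.range (fun y : RingQuot (genRel {r1, r2, r3, r4, r5, r6}) => h * y) =
              Set.range (fun y : RingQuot (genRel {r1, r2, r3, r4, r5, r6}) => y * h)) ∧
            h * π x1 = a ^ 2 • (π x1 * h) ∧
            h * π x2 = (a ^ 2)⁻¹ • (π x2 * h) ∧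
            h * π x3 = π x3 * h ∧
            h * π x4 = π x4 * h := by
  intro x1 x2 x3 x4 hx1 hx2 hx3 hx4 r1 r2 r3 r4 r5 r6 h1 h2 h3 h4 h5 h6 π hπ g h hg hh
  have surj : Function.Surjective π := hπ ▸ RingQuot.mkAlgHom_surjective k _
  have rel : ∀ {r s : FreeAlgebra k (Fin 4)}, r = s →
      r ∈ ({r1, r2, r3, r4, r5, r6} : Set (FreeAlgebra k (Fin 4))) → π s = 0 := by
    rintro r _ rfl hr
    rw [hπ, ← map_zero (RingQuot.mkAlgHom k (genRel {r1, r2, r3, r4, r5, r6}))]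
    exact RingQuot.mkAlgHom_rel k ⟨hr, rfl⟩
  have e1 := rel h1 (by simp)
  have e2 := rel h2 (by simp)
  have e3 := rel h3 (by simp)
  have e4 := rel h4 (by simp)
  have e5 := rel h5 (by simp)
  have e6 := rel h6 (by simp)
  have h33 : h = π x3 * π x3 := by
    rw [sub_sub, map_sub, sub_eq_zero, ← hh, map_pow, sq] at e1
    exact e1.symm
  have h44 : h = π x4 * π x4 := by
    rw [sub_sub, map_sub, sub_eq_zero, ← hh, map_pow, sq] at e4
    exact e4.symm
  rw [map_sub, sub_eq_zero, map_smul, map_mul, map_mul] at e2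
  rw [map_sub, sub_eq_zero, map_smul, map_mul, map_mul] at e3
  rw [map_sub, sub_eq_zero, map_smul, map_mul, map_mul] at e5
  rw [map_sub, sub_eq_zero, map_smul, map_mul, map_mul] at e6
  rw [map_sub, map_mul, map_mul] at hg
  have g1 : g * π x1 = a ^ 2 • (π x1 * g) := by
    rw [hg, sub_mul, mul_mul_eq_sq_smul e5 e2, mul_mul_eq_sq_smul e2 e5, mul_sub, smul_sub]
  have g2 : g * π x2 = (a ^ 2)⁻¹ • (π x2 * g) := by
    rw [hg, sub_mul, mul_mul_eq_sq_smul e6 e3, mul_mul_eq_sq_smul e3 e6, mul_sub, smul_sub,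
      inv_pow]
  have g3 : g * π x3 = -(π x3 * g) := by
    rw [hg]
    exact commutator_mul_right_eq_neg (h33.symm.trans h44)
  have g4 : g * π x4 = -(π x4 * g) := by
    rw [hg]
    exact commutator_mul_left_eq_neg (h33.symm.trans h44)
  have k1 : h * π x1 = a ^ 2 • (π x1 * h) := by
    rw [h33, mul_mul_eq_sq_smul e2 e2]
  have k2 : h * π x2 = (a ^ 2)⁻¹ • (π x2 * h) := by
    rw [h33, mul_mul_eq_sq_smul e3 e3, inv_pow]
  have k3 : h * π x3 = π x3 * h := by rw [h33, mul_assoc]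
  have k4 : h * π x4 = π x4 * h := by rw [h44, mul_assoc]
  refine ⟨?_, g1, g2, g3, g4, by rw [h33, map_pow, sq], by rw [h44, map_pow, sq], ?_,
    k1, k2, k3, k4⟩
  · refine range_mul_left_eq_range_mul_right π surj g ![a ^ 2, (a ^ 2)⁻¹, -1, -1] ?_ ?_
    · intro i
      fin_cases i <;> simp [ha]
    · subst hx1 hx2 hx3 hx4
      intro i
      fin_cases i
      · exact g1
      · exact g2
      · exact g3.trans (neg_one_smul k _).symm
      · exact g4.trans (neg_one_smul k _).symm
  · refine range_mul_left_eq_range_mul_right π surj h ![a ^ 2, (a ^ 2)⁻¹, 1, 1] ?_ ?_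
    · intro i
      fin_cases i <;> simp [ha]
    · subst hx1 hx2 hx3 hx4
      intro i
      fin_cases i
      · exact k1
      · exact k2
      · exact k3.trans (one_smul k _).symm
      · exact k4.trans (one_smul k _).symm
end
end

section
/- With the type A presentation data and hypotheses given in the context, let X = [x3, x1, x2, x4], let R be a 4×6 matrix and T a 6×4 matrix whose entries are k-linear combinations of x1, x2, x3, x4 in the free algebra k⟨x1,x2,x3,x4⟩ such that X·R = [r1, r2, r3, r4, r5, r6] and T·X^t = [r1, r2, r3, r4, r5, r6]^t as identities in the free algebra, and let S = (s_{ij}) be an invertible 6×6 matrix over k such that every entry of the matrix product R·S·T lies in the two-sided ideal of the free algebra generated by r1,…,r6 (that is, R·S·T = 0 in D). Then S is block diagonal: s_{ij} = 0 whenever i ∈ {1,2,3} and j ∈ {4,5,6}, and whenever i ∈ {4,5,6} and j ∈ {1,2,3}; in particular S = diag(S1, S2) with S1, S2 nonsingular 3×3 matrices over k. -/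
noncomputable section

open FreeAlgebra

/-- The row vector `X = [x3, x1, x2, x4]`. -/
def Xvec (k : Type) [Field k] : Fin 4 → FreeAlgebra k (Fin 4) :=
  ![FreeAlgebra.ι k 2, FreeAlgebra.ι k 0, FreeAlgebra.ι k 1, FreeAlgebra.ι k 3]

/-- The vector `[r1, r2, r3, r4, r5, r6]` of relations of `D`, viewed in
`k⟨x1,x2,x3,x4⟩`. -/
def rvec (k : Type) [Field k] (c1 c2 c3 c4 c5 c6 : Fin 3 → Fin 3 → k) :
    Fin 6 → FreeAlgebra k (Fin 4) :=
  ![inclA k (rA1 k c1), inclA k (rA2 k c2), inclA k (rA3 k c3),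
    inclB k (rB4 k c4), inclB k (rB5 k c5), inclB k (rB6 k c6)]

/-- The nilpotent matrix representing the generator `x_a`, whose products of length two are governed
by the bilinear form `l`. -/
def pairMat {k : Type} [Field k] {n : ℕ} (l : Fin n → Fin n → k) (a : Fin n) :
    Matrix (Option (Option (Fin n))) (Option (Option (Fin n))) k :=
  Matrix.of fun u v => match u, v with
    | none, some (some c) => if c = a then 1 else 0
    | some (some c), some none => l c a
    | _, _ => 0

/-- The representation of the free algebra attached to a bilinear form `l`: the word `x_a x_b` has
`l a b` as its only nonzero entry. -/
def pairRep {k : Type} [Field k] {n : ℕ} (l : Fin n → Fin n → k) :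
    FreeAlgebra k (Fin n) →ₐ[k]
      Matrix (Option (Option (Fin n))) (Option (Option (Fin n))) k :=
  FreeAlgebra.lift k (pairMat l)

theorem pairRep_ι_mul_ι {k : Type} [Field k] {n : ℕ} (l : Fin n → Fin n → k) (a b : Fin n) :
    pairRep l (ι k a * ι k b) = Matrix.single none (some none) (l a b) := by
  ext u v
  rw [map_mul, Matrix.mul_apply]
  simp only [pairRep, FreeAlgebra.lift_ι_apply, Fintype.sum_option]
  rcases u with _ | _ | u <;> rcases v with _ | _ | v <;>
    simp [pairMat, Matrix.single, Matrix.of_apply]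

theorem mkAlgHom_genRel_eq_zero_imp {k : Type} [Field k] {n : ℕ}
    {s : Set (FreeAlgebra k (Fin n))} {B : Type} [Semiring B] [Algebra k B]
    (φ : FreeAlgebra k (Fin n) →ₐ[k] B) (hφ : ∀ r ∈ s, φ r = 0) {x : FreeAlgebra k (Fin n)}
    (hx : RingQuot.mkAlgHom k (genRel s) x = 0) : φ x = 0 := by
  have h : ∀ ⦃a b⦄, genRel s a b → φ a = φ b := by
    rintro a b ⟨ha, rfl⟩
    rw [hφ a ha, map_zero]
  rw [← RingQuot.liftAlgHom_mkAlgHom_apply k φ h x, hx, map_zero]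

theorem exists_eq_sum_ι_of_mem_degF_one {k : Type} [Field k] {n : ℕ}
    {x : FreeAlgebra k (Fin n)} (hx : x ∈ degF k n 1) :
    ∃ ρ : Fin n → k, x = ∑ a, ρ a • ι k a := by
  rw [degF, pow_one, Submodule.mem_span_range_iff_exists_fun] at hx
  obtain ⟨ρ, h⟩ := hx
  exact ⟨ρ, h.symm⟩

/-- The value of a bilinear form on the relations `r1, …, r6`. -/
def relPairing {k : Type} [Field k] (c1 c2 c3 c4 c5 c6 : Fin 3 → Fin 3 → k)
    (l : Fin 4 → Fin 4 → k) : Fin 6 → k :=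
  ![l 2 2 - ∑ i, ∑ j, c1 i j * l (![0, 1, 2] i) (![0, 1, 2] j),
    l 2 0 - ∑ i, ∑ j, c2 i j * l (![0, 1, 2] i) (![0, 1, 2] j),
    l 2 1 - ∑ i, ∑ j, c3 i j * l (![0, 1, 2] i) (![0, 1, 2] j),
    l 3 0 - ∑ i, ∑ j, c4 i j * l (![0, 1, 3] i) (![0, 1, 3] j),
    l 3 1 - ∑ i, ∑ j, c5 i j * l (![0, 1, 3] i) (![0, 1, 3] j),
    l 3 3 - ∑ i, ∑ j, c6 i j * l (![0, 1, 3] i) (![0, 1, 3] j)]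

theorem pairRep_inclA_quad {k : Type} [Field k] (l : Fin 4 → Fin 4 → k) (c : Fin 3 → Fin 3 → k) :
    pairRep l (inclA k (quad k c)) = Matrix.single none (some none)
      (∑ i, ∑ j, c i j * l (![0, 1, 2] i) (![0, 1, 2] j)) := by
  have h : ∀ i : Fin 3, (Fin.castLE (by norm_num) i : Fin 4) = ![0, 1, 2] i := by decide
  simp only [quad, inclA, map_sum, map_smul, map_mul, FreeAlgebra.lift_ι_apply, h]
  simp only [← map_mul, pairRep_ι_mul_ι, ← map_smul, smul_eq_mul,
    ← Matrix.singleLinearMap_apply k, map_sum]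

theorem pairRep_inclB_quad {k : Type} [Field k] (l : Fin 4 → Fin 4 → k) (c : Fin 3 → Fin 3 → k) :
    pairRep l (inclB k (quad k c)) = Matrix.single none (some none)
      (∑ i, ∑ j, c i j * l (![0, 1, 3] i) (![0, 1, 3] j)) := by
  simp only [quad, inclB, map_sum, map_smul, map_mul, FreeAlgebra.lift_ι_apply]
  simp only [← map_mul, pairRep_ι_mul_ι, ← map_smul, smul_eq_mul,
    ← Matrix.singleLinearMap_apply k, map_sum]

theorem pairRep_rvec {k : Type} [Field k] (c1 c2 c3 c4 c5 c6 : Fin 3 → Fin 3 → k)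
    (l : Fin 4 → Fin 4 → k) (p : Fin 6) :
    pairRep l (rvec k c1 c2 c3 c4 c5 c6 p) =
      Matrix.single none (some none) (relPairing c1 c2 c3 c4 c5 c6 l p) := by
  have hA : ∀ i j : Fin 3, inclA k (ι k i * ι k j) =
      ι k (![0, 1, 2] i) * ι k (![0, 1, 2] j) := by
    have h : ∀ i : Fin 3, (Fin.castLE (by norm_num) i : Fin 4) = ![0, 1, 2] i := by decide
    intro i j
    simp only [inclA, map_mul, FreeAlgebra.lift_ι_apply, h]
  have hB : ∀ i j : Fin 3, inclB k (ι k i * ι k j) =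
      ι k (![0, 1, 3] i) * ι k (![0, 1, 3] j) := by
    intro i j
    simp only [inclB, map_mul, FreeAlgebra.lift_ι_apply]
  have hs : ∀ x y : k, Matrix.single none (some none) x - Matrix.single none (some none) y =
      (Matrix.single none (some none) (x - y) :
        Matrix (Option (Option (Fin 4))) (Option (Option (Fin 4))) k) := fun x y =>
    ((Matrix.singleLinearMap k none (some none)).map_sub x y).symm
  fin_cases p <;>
    simp [rvec, relPairing, rA1, rA2, rA3, rB4, rB5, rB6, map_sub, hA, hB, -map_mul,
      pairRep_ι_mul_ι, pairRep_inclA_quad, pairRep_inclB_quad, hs]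

theorem pairRep_sum_mul_sum {k : Type} [Field k] {n : ℕ} (l : Fin n → Fin n → k)
    (ρ τ : Fin n → k) :
    pairRep l ((∑ a, ρ a • ι k a) * ∑ b, τ b • ι k b) =
      Matrix.single none (some none) (∑ a, ∑ b, ρ a * τ b * l a b) := by
  simp only [Finset.sum_mul_sum, smul_mul_smul_comm, map_sum, map_smul, pairRep_ι_mul_ι,
    ← Matrix.singleLinearMap_apply k]
  simp only [← map_smul, smul_eq_mul]

/-- The coefficient of the word `x_a x_b` in the relation `r_p`. -/
def relCoeff {k : Type} [Field k] (c1 c2 c3 c4 c5 c6 : Fin 3 → Fin 3 → k)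
    (p : Fin 6) (a b : Fin 4) : k :=
  relPairing c1 c2 c3 c4 c5 c6 (fun i j => if i = a ∧ j = b then 1 else 0) p

/-- The position of each entry of `X` among the generators. -/
def Xidx : Fin 4 → Fin 4 := ![2, 0, 1, 3]

theorem Xvec_eq (k : Type) [Field k] (i : Fin 4) : Xvec k i = ι k (Xidx i) := by
  fin_cases i <;> rfl

theorem Xidx_injective : Function.Injective Xidx := by decide

theorem left_coeff_eq {k : Type} [Field k] {c1 c2 c3 c4 c5 c6 : Fin 3 → Fin 3 → k} {p : Fin 6}
    {ρ : Fin 4 → Fin 4 → k}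
    (h : ∑ i, Xvec k i * ∑ a, ρ i a • ι k a = rvec k c1 c2 c3 c4 c5 c6 p) (i a : Fin 4) :
    ρ i a = relCoeff c1 c2 c3 c4 c5 c6 p (Xidx i) a := by
  have h' := congrArg (fun x => pairRep
    (fun u v => if u = Xidx i ∧ v = a then (1 : k) else 0) x none (some none)) h
  simp only [pairRep_rvec, Matrix.single_apply_same, Xvec_eq, Finset.mul_sum, mul_smul_comm,
    map_sum, map_smul, pairRep_ι_mul_ι, Matrix.sum_apply, Matrix.smul_apply,
    Xidx_injective.eq_iff] at h'
  rw [relCoeff, ← h']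
  simp [ite_and]

theorem right_coeff_eq {k : Type} [Field k] {c1 c2 c3 c4 c5 c6 : Fin 3 → Fin 3 → k} {p : Fin 6}
    {τ : Fin 4 → Fin 4 → k}
    (h : ∑ j, (∑ b, τ j b • ι k b) * Xvec k j = rvec k c1 c2 c3 c4 c5 c6 p) (j b : Fin 4) :
    τ j b = relCoeff c1 c2 c3 c4 c5 c6 p b (Xidx j) := by
  have h' := congrArg (fun x => pairRep
    (fun u v => if u = b ∧ v = Xidx j then (1 : k) else 0) x none (some none)) h
  simp only [pairRep_rvec, Matrix.single_apply_same, Xvec_eq, Finset.sum_mul, smul_mul_assoc,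
    map_sum, map_smul, pairRep_ι_mul_ι, Matrix.sum_apply, Matrix.smul_apply,
    Xidx_injective.eq_iff] at h'
  rw [relCoeff, ← h']
  simp [ite_and]

/-- Every bilinear form vanishing on the relations of `D` vanishes on the entries of `R·S·T`,
expressed through the coefficients of the relations. -/
theorem sum_relCoeff_eq_zero {k : Type} [Field k] {c1 c2 c3 c4 c5 c6 : Fin 3 → Fin 3 → k}
    {R : Matrix (Fin 4) (Fin 6) (FreeAlgebra k (Fin 4))}
    {T : Matrix (Fin 6) (Fin 4) (FreeAlgebra k (Fin 4))}
    (hRlin : ∀ i j, R i j ∈ degF k 4 1) (hTlin : ∀ i j, T i j ∈ degF k 4 1)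
    (hXR : ∀ j : Fin 6, ∑ i, Xvec k i * R i j = rvec k c1 c2 c3 c4 c5 c6 j)
    (hTX : ∀ i : Fin 6, ∑ j, T i j * Xvec k j = rvec k c1 c2 c3 c4 c5 c6 i)
    {S : Matrix (Fin 6) (Fin 6) k}
    (hRST : ∀ (i : Fin 4) (j : Fin 4),
      RingQuot.mkAlgHom k (genRel (setD k c1 c2 c3 c4 c5 c6))
        ((R * S.map (algebraMap k (FreeAlgebra k (Fin 4))) * T) i j) = 0)
    (l : Fin 4 → Fin 4 → k) (hl : ∀ p, relPairing c1 c2 c3 c4 c5 c6 l p = 0) (i j : Fin 4) :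
    ∑ q, ∑ p, S p q * ∑ a, ∑ b, relCoeff c1 c2 c3 c4 c5 c6 p (Xidx i) a *
      relCoeff c1 c2 c3 c4 c5 c6 q b (Xidx j) * l a b = 0 := by
  choose ρ hρ using fun i j => exists_eq_sum_ι_of_mem_degF_one (hRlin i j)
  choose τ hτ using fun i j => exists_eq_sum_ι_of_mem_degF_one (hTlin i j)
  have eρ : ∀ p i a, ρ i p a = relCoeff c1 c2 c3 c4 c5 c6 p (Xidx i) a := fun p i a =>
    left_coeff_eq (ρ := fun i a => ρ i p a) (by simpa only [hρ] using hXR p) i a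
  have eτ : ∀ q j b, τ q j b = relCoeff c1 c2 c3 c4 c5 c6 q b (Xidx j) := fun q j b =>
    right_coeff_eq (τ := fun j b => τ q j b) (by simpa only [hτ] using hTX q) j b
  have hz : ∀ r ∈ setD k c1 c2 c3 c4 c5 c6, pairRep l r = 0 := by
    have hr : ∀ p, pairRep l (rvec k c1 c2 c3 c4 c5 c6 p) = 0 := fun p => by
      rw [pairRep_rvec, hl, Matrix.single_zero]
    rintro r (rfl | rfl | rfl | rfl | rfl | rfl)
    exacts [hr 0, hr 1, hr 2, hr 3, hr 4, hr 5]
  have h := mkAlgHom_genRel_eq_zero_imp (pairRep l) hz (hRST i j)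
  have e : (R * S.map (algebraMap k (FreeAlgebra k (Fin 4))) * T) i j =
      ∑ q, ∑ p, S p q • (R i p * T q j) := by
    simp only [Matrix.mul_apply, Matrix.map_apply, Finset.sum_mul, ← Algebra.commutes,
      Algebra.smul_def, mul_assoc]
  rw [e] at h
  simp only [hρ i, hτ _ j, map_sum, map_smul, pairRep_sum_mul_sum] at h
  have h' := congrFun (congrFun h none) (some none)
  simpa only [Matrix.sum_apply, Matrix.smul_apply, Matrix.single_apply_same, smul_eq_mul, eρ, eτ,
    Matrix.zero_apply] using h'

/-- The bilinear form on `x1, x2, x3, x4` that vanishes on words in `x1, x2, x3`, takes the value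
`f` on the words `x_i x4`, and has the last row `g`. -/
def formAB {k : Type} [Field k] (f g : Fin 3 → k) : Fin 4 → Fin 4 → k :=
  ![![0, 0, 0, f 0], ![0, 0, 0, f 1], ![0, 0, 0, f 2], ![g 0, g 1, 0, g 2]]

/-- The analogue of `formAB` with the roles of `x3` and `x4` exchanged. -/
def formBA {k : Type} [Field k] (f g : Fin 3 → k) : Fin 4 → Fin 4 → k :=
  ![![0, 0, f 0, 0], ![0, 0, f 1, 0], ![g 0, g 1, g 2, 0], ![0, 0, f 2, 0]]

/-- The block of `S` pairing the relations of `A` with those of `B` vanishes. -/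
theorem upper_block_eq_zero {k : Type} [Field k] {c1 c2 c3 c4 c5 c6 : Fin 3 → Fin 3 → k}
    (z1 : c1 2 2 = 0) (z2 : ∀ j, c2 2 j = 0) (z3 : c3 2 1 = 0 ∧ c3 2 2 = 0)
    (z4 : ∀ j, c4 2 j = 0) (z5 : c5 2 1 = 0 ∧ c5 2 2 = 0) (z6 : c6 2 2 = 0)
    {S : Matrix (Fin 6) (Fin 6) k}
    (main : ∀ l : Fin 4 → Fin 4 → k, (∀ p, relPairing c1 c2 c3 c4 c5 c6 l p = 0) →
      ∀ i j : Fin 4, ∑ q, ∑ p, S p q * ∑ a, ∑ b,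
        relCoeff c1 c2 c3 c4 c5 c6 p (Xidx i) a *
          relCoeff c1 c2 c3 c4 c5 c6 q b (Xidx j) * l a b = 0) :
    ∀ i j : Fin 6, (i : ℕ) ≤ 2 → 3 ≤ (j : ℕ) → S i j = 0 := by
  have key : ∀ f : Fin 3 → k, ∀ j : Fin 6, 3 ≤ (j : ℕ) →
      S 0 j * (f 2 - c1 2 0 * f 0 - c1 2 1 * f 1) + S 1 j * f 0
        + S 2 j * (f 1 - c3 2 0 * f 0) = 0 := by
    intro f
    let g0 := c4 0 2 * f 0 + c4 1 2 * f 1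
    let g1 := c5 2 0 * g0 + c5 0 2 * f 0 + c5 1 2 * f 1
    let g2 := c6 2 0 * g0 + c6 2 1 * g1 + c6 0 2 * f 0 + c6 1 2 * f 1
    have hl : ∀ p, relPairing c1 c2 c3 c4 c5 c6 (formAB f ![g0, g1, g2]) p = 0 := by
      intro p
      fin_cases p <;>
        simp [relPairing, formAB, Fin.sum_univ_succ, z4, z5, z6, g0, g1, g2] <;> ring
    have e3 := main _ hl 0 3
    have e2 := main _ hl 0 2
    have e1 := main _ hl 0 1
    simp [Xidx, relCoeff, relPairing, formAB, Fin.sum_univ_succ, z1, z2, z3, z4, z5, z6]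
      at e1 e2 e3
    intro j hj
    obtain rfl | rfl | rfl : j = 3 ∨ j = 4 ∨ j = 5 := by omega
    · linear_combination e1 + c5 2 0 * (e2 + c6 2 1 * e3) + c6 2 0 * e3
    · linear_combination e2 + c6 2 1 * e3
    · linear_combination e3
  intro i j hi hj
  have k2 := key ![0, 0, 1] j hj
  have k1 := key ![0, 1, 0] j hj
  have k0 := key ![1, 0, 0] j hj
  simp at k0 k1 k2
  simp only [k2, zero_mul, neg_zero, zero_add] at k1
  simp [k1, k2] at k0
  obtain rfl | rfl | rfl : i = 0 ∨ i = 1 ∨ i = 2 := by omega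
  exacts [k2, k0, k1]

/-- The block of `S` pairing the relations of `B` with those of `A` vanishes. -/
theorem lower_block_eq_zero {k : Type} [Field k] {c1 c2 c3 c4 c5 c6 : Fin 3 → Fin 3 → k}
    (z1 : c1 2 2 = 0) (z2 : ∀ j, c2 2 j = 0) (z3 : c3 2 1 = 0 ∧ c3 2 2 = 0)
    (z4 : ∀ j, c4 2 j = 0) (z5 : c5 2 1 = 0 ∧ c5 2 2 = 0) (z6 : c6 2 2 = 0)
    {S : Matrix (Fin 6) (Fin 6) k}
    (main : ∀ l : Fin 4 → Fin 4 → k, (∀ p, relPairing c1 c2 c3 c4 c5 c6 l p = 0) →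
      ∀ i j : Fin 4, ∑ q, ∑ p, S p q * ∑ a, ∑ b,
        relCoeff c1 c2 c3 c4 c5 c6 p (Xidx i) a *
          relCoeff c1 c2 c3 c4 c5 c6 q b (Xidx j) * l a b = 0) :
    ∀ i j : Fin 6, 3 ≤ (i : ℕ) → (j : ℕ) ≤ 2 → S i j = 0 := by
  have key : ∀ f : Fin 3 → k, ∀ j : Fin 6, (j : ℕ) ≤ 2 →
      S 3 j * f 0 + S 4 j * (f 1 - c5 2 0 * f 0)
        + S 5 j * (f 2 - c6 2 0 * f 0 - c6 2 1 * f 1) = 0 := by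
    intro f
    let g0 := c2 0 2 * f 0 + c2 1 2 * f 1
    let g1 := c3 2 0 * g0 + c3 0 2 * f 0 + c3 1 2 * f 1
    let g2 := c1 2 0 * g0 + c1 2 1 * g1 + c1 0 2 * f 0 + c1 1 2 * f 1
    have hl : ∀ p, relPairing c1 c2 c3 c4 c5 c6 (formBA f ![g0, g1, g2]) p = 0 := by
      intro p
      fin_cases p <;>
        simp [relPairing, formBA, Fin.sum_univ_succ, z1, z2, z3, g0, g1, g2] <;> ring
    have e0 := main _ hl 3 0
    have e2 := main _ hl 3 2
    have e1 := main _ hl 3 1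
    simp [Xidx, relCoeff, relPairing, formBA, Fin.sum_univ_succ, z1, z2, z3, z4, z5, z6]
      at e0 e1 e2
    intro j hj
    obtain rfl | rfl | rfl : j = 0 ∨ j = 1 ∨ j = 2 := by omega
    · linear_combination e0
    · linear_combination e1 + c3 2 0 * (e2 + c1 2 1 * e0) + c1 2 0 * e0
    · linear_combination e2 + c1 2 1 * e0
  intro i j hi hj
  have k2 := key ![0, 0, 1] j hj
  have k1 := key ![0, 1, 0] j hj
  have k0 := key ![1, 0, 0] j hj
  simp at k0 k1 k2
  simp only [k2, zero_mul, neg_zero, add_zero] at k1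
  simp [k1, k2] at k0
  obtain rfl | rfl | rfl : i = 3 ∨ i = 4 ∨ i = 5 := by omega
  exacts [k0, k1, k2]

/-- with the type A presentation data and hypotheses, if
`X = [x3,x1,x2,x4]`, `R` is a `4×6` matrix and `T` a `6×4` matrix with
degree-one entries such that `X·R = [r1,…,r6]` and `T·Xᵗ = [r1,…,r6]ᵗ` in the
free algebra, and `S` is an invertible `6×6` scalar matrix with `R·S·T = 0`
in `D`, then `S` is block diagonal: the off-diagonal `3×3` blocks vanish and
the two diagonal `3×3` blocks are nonsingular. -/
theorem stmt19 (k : Type) [Field k] [IsAlgClosed k] [CharZero k]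
    (c1 c2 c3 c4 c5 c6 : Fin 3 → Fin 3 → k)
    (c7 c8 : Fin 2 → Fin 2 → Fin 2 → k)
    -- deg-lex support conditions on the lower-order parts f1,…,f8
    (h1 : ∀ i j : Fin 3, c1 i j ≠ 0 → i < 2 ∨ (i = 2 ∧ j < 2))
    (h2 : ∀ i j : Fin 3, c2 i j ≠ 0 → i < 2)
    (h3 : ∀ i j : Fin 3, c3 i j ≠ 0 → i < 2 ∨ (i = 2 ∧ j = 0))
    (h4 : ∀ i j : Fin 3, c4 i j ≠ 0 → i < 2)
    (h5 : ∀ i j : Fin 3, c5 i j ≠ 0 → i < 2 ∨ (i = 2 ∧ j = 0))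
    (h6 : ∀ i j : Fin 3, c6 i j ≠ 0 → i < 2 ∨ (i = 2 ∧ j < 2))
    (h7 : ∀ i j l : Fin 2, c7 i j l ≠ 0 → i = 0 ∨ (i = 1 ∧ j = 0))
    (h8 : ∀ i j l : Fin 2, c8 i j l ≠ 0 → i = 0)
    -- A and B have the Hilbert function of a regular quadratic algebra of
    -- global dimension three
    (hAdim : ∀ n : ℕ,
      Module.finrank k (degQ k (setA k c1 c2 c3) n) = (n + 2).choose 2)
    (hBdim : ∀ n : ℕ,
      Module.finrank k (degQ k (setB k c4 c5 c6) n) = (n + 2).choose 2)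
    -- r7 and r8 lie in the defining ideals of A and of B
    (hC7A : RingQuot.mkAlgHom k (genRel (setA k c1 c2 c3)) (inclC k (rC7 k c7)) = 0)
    (hC8A : RingQuot.mkAlgHom k (genRel (setA k c1 c2 c3)) (inclC k (rC8 k c8)) = 0)
    (hC7B : RingQuot.mkAlgHom k (genRel (setB k c4 c5 c6)) (inclC k (rC7 k c7)) = 0)
    (hC8B : RingQuot.mkAlgHom k (genRel (setB k c4 c5 c6)) (inclC k (rC8 k c8)) = 0)
    -- the matrices R, T with degree-one entries
    (R : Matrix (Fin 4) (Fin 6) (FreeAlgebra k (Fin 4)))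
    (T : Matrix (Fin 6) (Fin 4) (FreeAlgebra k (Fin 4)))
    (hRlin : ∀ i j, R i j ∈ degF k 4 1)
    (hTlin : ∀ i j, T i j ∈ degF k 4 1)
    (hXR : ∀ j : Fin 6, ∑ i, Xvec k i * R i j = rvec k c1 c2 c3 c4 c5 c6 j)
    (hTX : ∀ i : Fin 6, ∑ j, T i j * Xvec k j = rvec k c1 c2 c3 c4 c5 c6 i)
    -- the invertible scalar matrix S with R·S·T = 0 in D
    (S : Matrix (Fin 6) (Fin 6) k) (hS : IsUnit S)
    (hRST : ∀ (i : Fin 4) (j : Fin 4),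
      RingQuot.mkAlgHom k (genRel (setD k c1 c2 c3 c4 c5 c6))
        ((R * S.map (algebraMap k (FreeAlgebra k (Fin 4))) * T) i j) = 0) :
    (∀ i j : Fin 6, (i : ℕ) ≤ 2 → 3 ≤ (j : ℕ) → S i j = 0) ∧
    (∀ i j : Fin 6, 3 ≤ (i : ℕ) → (j : ℕ) ≤ 2 → S i j = 0) ∧
    IsUnit (Matrix.of fun i j : Fin 3 =>
      S (Fin.castLE (by omega) i) (Fin.castLE (by omega) j)) ∧
    IsUnit (Matrix.of fun i j : Fin 3 =>
      S ⟨(i : ℕ) + 3, by omega⟩ ⟨(j : ℕ) + 3, by omega⟩) := by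
  have z1 : c1 2 2 = 0 := by by_contra h; simpa using h1 _ _ h
  have z2 : ∀ j, c2 2 j = 0 := fun j => by by_contra h; simpa using h2 _ _ h
  have z3 : c3 2 1 = 0 ∧ c3 2 2 = 0 := by
    constructor <;> by_contra h <;> simpa using h3 _ _ h
  have z4 : ∀ j, c4 2 j = 0 := fun j => by by_contra h; simpa using h4 _ _ h
  have z5 : c5 2 1 = 0 ∧ c5 2 2 = 0 := by
    constructor <;> by_contra h <;> simpa using h5 _ _ h
  have z6 : c6 2 2 = 0 := by by_contra h; simpa using h6 _ _ h
  have main := sum_relCoeff_eq_zero hRlin hTlin hXR hTX hRST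
  have hAB := upper_block_eq_zero z1 z2 z3 z4 z5 z6 main
  have hBA := lower_block_eq_zero z1 z2 z3 z4 z5 z6 main
  have hSe : S.submatrix (finSumFinEquiv (m := 3) (n := 3)) (finSumFinEquiv (m := 3) (n := 3)) =
      Matrix.fromBlocks
        (Matrix.of fun i j : Fin 3 => S (Fin.castLE (by omega) i) (Fin.castLE (by omega) j)) 0 0
        (Matrix.of fun i j : Fin 3 =>
          S ⟨(i : ℕ) + 3, by omega⟩ ⟨(j : ℕ) + 3, by omega⟩) := by
    ext (i | i) (j | j)
    · rfl
    · exact hAB _ _ (Nat.le_of_lt_succ i.isLt) (Nat.le_add_right 3 j)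
    · exact hBA _ _ (Nat.le_add_right 3 i) (Nat.le_of_lt_succ j.isLt)
    · simp only [Matrix.submatrix_apply, finSumFinEquiv_apply_right, Matrix.fromBlocks_apply₂₂,
        Matrix.of_apply]
      congr 1 <;> ext <;> simp
  have hdet := (Matrix.isUnit_iff_isUnit_det S).1 hS
  rw [← Matrix.det_submatrix_equiv_self (finSumFinEquiv (m := 3) (n := 3)) S, hSe,
    Matrix.det_fromBlocks_zero₁₂, IsUnit.mul_iff] at hdet
  exact ⟨hAB, hBA, (Matrix.isUnit_iff_isUnit_det _).2 hdet.1,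
    (Matrix.isUnit_iff_isUnit_det _).2 hdet.2⟩
end
end
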